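/- There exists a constant c > 0 such that for all 0 < η ≤ 1/2, all α, β ∈ ℝ, and all q ∈ 𝕋³: (i) ∫_{𝕋³} dp / ( |α − e(p) + iη| · |β − e(p+q) + iη| ) ≤ c η^{−3/4} |log η|³ / |||q|||; and (ii) ∫_{−12}^{12} dα ∫_{𝕋³} dp / ( |α − e(p) + iη| · |α − e(p+q) + iη| ) ≤ c η^{−1/2} |log η|³ / |||q|||. -/

import Mathlib

open MeasureTheory Filter Topology

noncomputable section

/-- The torus `𝕋³ = [-1/2, 1/2]³` realized as a box in `ℝ³`. -/
def T3 : Set (Fin 3 → ℝ) := Set.pi Set.univ fun _ => Set.Icc (-(1/2) : ℝ) (1/2)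

/-- The lattice dispersion relation `e(p) = ∑_j (1 - cos(2π p_j))`. -/
def edisp (p : Fin 3 → ℝ) : ℝ := ∑ j, (1 - Real.cos (2 * Real.pi * p j))

/-- `Θ_ε(α) = ∫_{𝕋³} dq / (α - e(q) + iε)`. -/
def ThetaEps (ε α : ℝ) : ℂ := ∫ q in T3, ((α : ℂ) - (edisp q : ℂ) + (ε : ℂ) * Complex.I)⁻¹

/-- `Θ` is the limit of `Θ_ε` as `ε → 0⁺`. -/
def IsThetaLimit (Θ : ℝ → ℂ) : Prop :=
  ∀ α : ℝ, Tendsto (fun ε => ThetaEps ε α) (𝓝[>] (0 : ℝ)) (𝓝 (Θ α))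

/-- The renormalized dispersion `ω(p) = e(p) + λ² Θ(e(p))`. -/
def omegaR (Θ : ℝ → ℂ) (lam : ℝ) (p : Fin 3 → ℝ) : ℂ :=
  (edisp p : ℂ) + (lam : ℂ) ^ 2 * Θ (edisp p)

/-- A function on `𝕋³`, i.e. a `ℤ³`-periodic function on `ℝ³`. -/
def ZPeriodic (g : (Fin 3 → ℝ) → ℂ) : Prop :=
  ∀ (p : Fin 3 → ℝ) (n : Fin 3 → ℤ), g (p + fun j => (n j : ℝ)) = g p

/-- The `C¹` norm `‖g‖_∞ + ‖∇g‖_∞`. -/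
def C1Norm (g : (Fin 3 → ℝ) → ℂ) : ℝ :=
  (⨆ p : Fin 3 → ℝ, ‖g p‖) + ⨆ p : Fin 3 → ℝ, ‖fderiv ℝ g p‖

/-- `|||α||| = min {|α|, |α-2|, |α-3|, |α-4|, |α-6|}`. -/
def anorm (a : ℝ) : ℝ := min (min (min |a| |a - 2|) (min |a - 3| |a - 4|)) |a - 6|

/-- Distance between two points of the circle `ℝ/ℤ`. -/
def cdist (x y : ℝ) : ℝ := |x - y - (round (x - y) : ℝ)|

/-- `|||q||| = η + min {dist(q, γ) : γ a critical point of e}` (torus distance);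
the critical points are exactly the points with all coordinates in `{0, 1/2}` mod `1`,
and minimizing over them coordinatewise gives the formula below. -/
def tnorm (η : ℝ) (q : Fin 3 → ℝ) : ℝ :=
  η + Real.sqrt (∑ j, (min (cdist (q j) 0) (cdist (q j) (1/2))) ^ 2)

/-- `|∇e(q)|`, the Euclidean length of the gradient of the dispersion relation. -/
def gradNorm (q : Fin 3 → ℝ) : ℝ := Real.sqrt (∑ j, (2 * Real.pi * Real.sin (2 * Real.pi * q j)) ^ 2)



def uI : Set ℝ := Set.Icc (-(1/2) : ℝ) (1/2)

lemma volume_uI : volume uI = 1 := by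
  simp [uI]; norm_num

lemma measurableSet_uI : MeasurableSet uI := measurableSet_Icc

lemma one_le_rpow_enn {x : ENNReal} {b : ℝ} (h : 1 ≤ x) (hb : 0 ≤ b) : 1 ≤ x ^ b := by
  calc (1 : ENNReal) = 1 ^ b := by simp
    _ ≤ _ := ENNReal.rpow_le_rpow h hb

lemma rpow_anti {x y : ENNReal} (b : ℝ) (hb : 0 ≤ b) (h : x ≤ y) : y ^ (-b) ≤ x ^ (-b) := by
  rw [ENNReal.rpow_neg, ENNReal.rpow_neg]
  exact ENNReal.inv_le_inv.2 (ENNReal.rpow_le_rpow h hb)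

lemma lint_pow_half (b : ℝ) (hb : b < 1) :
    ∫⁻ x in Set.Ioc (0:ℝ) 1, (ENNReal.ofReal |x|) ^ (-b) = ENNReal.ofReal (1 / (1 - b)) := by
  have h1 : IntervalIntegrable (fun x : ℝ => x ^ (-b)) volume 0 1 :=
    intervalIntegral.intervalIntegrable_rpow' (by linarith)
  have h2 : ∫ x in (0:ℝ)..1, x ^ (-b) = 1 / (1 - b) := by
    rw [integral_rpow (Or.inl (by linarith))]
    rw [Real.zero_rpow (by linarith), Real.one_rpow]
    ring_nf
  rw [intervalIntegral.integral_of_le zero_le_one] at h2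
  rw [← h2, ofReal_integral_eq_lintegral_ofReal]
  · apply setLIntegral_congr_fun measurableSet_Ioc
    intro x hx
    have hx0 : 0 < x := hx.1
    simp only
    rw [abs_of_pos hx0, ENNReal.ofReal_rpow_of_pos hx0]
  · exact (intervalIntegrable_iff_integrableOn_Ioc_of_le zero_le_one).1 h1
  · filter_upwards [ae_restrict_mem measurableSet_Ioc] with x hx
    exact Real.rpow_nonneg hx.1.le _

lemma lint_pow_ball (b : ℝ) (hb0 : 0 ≤ b) (hb : b < 1) :
    ∫⁻ x in Set.Icc (-1:ℝ) 1, (ENNReal.ofReal |x|) ^ (-b) ≤ ENNReal.ofReal (2 / (1 - b)) := by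
  have hsub : Set.Icc (-1:ℝ) 1 ⊆ (Set.Ioc 0 1 ∪ Set.Ico (-1) 0) ∪ {0} := by
    intro x hx
    rcases lt_trichotomy x 0 with h | h | h
    · left; right; exact ⟨hx.1, h⟩
    · right; exact h
    · left; left; exact ⟨h, hx.2⟩
  have hneg : ∫⁻ x in Set.Ico (-1:ℝ) 0, (ENNReal.ofReal |x|) ^ (-b)
      = ∫⁻ x in Set.Ioc (0:ℝ) 1, (ENNReal.ofReal |x|) ^ (-b) := by
    have hmp : MeasurePreserving (fun x : ℝ => -x) volume volume :=
      Measure.measurePreserving_neg volume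
    have := hmp.setLIntegral_comp_preimage (s := Set.Ico (-1:ℝ) 0) measurableSet_Ico
      (f := fun x => (ENNReal.ofReal |x|) ^ (-b)) (by fun_prop)
    rw [← this]
    simp
  calc _ ≤ ∫⁻ x in (Set.Ioc (0:ℝ) 1 ∪ Set.Ico (-1) 0) ∪ {0}, (ENNReal.ofReal |x|) ^ (-b) :=
        lintegral_mono_set hsub
    _ ≤ (∫⁻ x in (Set.Ioc (0:ℝ) 1 ∪ Set.Ico (-1) 0), (ENNReal.ofReal |x|) ^ (-b)) +
        ∫⁻ x in ({0} : Set ℝ), (ENNReal.ofReal |x|) ^ (-b) := lintegral_union_le _ _ _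
    _ ≤ ((∫⁻ x in (Set.Ioc (0:ℝ) 1), (ENNReal.ofReal |x|) ^ (-b)) +
        (∫⁻ x in (Set.Ico (-1:ℝ) 0), (ENNReal.ofReal |x|) ^ (-b))) + 0 := by
        gcongr
        · exact lintegral_union_le _ _ _
        · simp
    _ = ENNReal.ofReal (2 / (1 - b)) := by
        rw [hneg, lint_pow_half b hb, add_zero, ← ENNReal.ofReal_add]
        · congr 1; ring
        · exact div_nonneg zero_le_one (by linarith)
        · exact div_nonneg zero_le_one (by linarith)

lemma lint_pow_shift (b : ℝ) (hb0 : 0 ≤ b) (hb : b < 1) (c : ℝ) :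
    ∫⁻ x in uI, (ENNReal.ofReal |x - c|) ^ (-b) ≤ ENNReal.ofReal (3 / (1 - b)) := by
  have key : ∀ x : ℝ, (ENNReal.ofReal |x - c|) ^ (-b) ≤
      (Set.Icc (-1:ℝ) 1).indicator (fun y => (ENNReal.ofReal |y|) ^ (-b)) (x - c) + 1 := by
    intro x
    by_cases h : |x - c| ≤ 1
    · rw [Set.indicator_of_mem (show x - c ∈ Set.Icc (-1:ℝ) 1 from abs_le.1 h)]
      exact le_self_add
    · push Not at h
      refine le_trans ?_ le_add_self
      rw [ENNReal.rpow_neg]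
      apply ENNReal.inv_le_one.2
      apply one_le_rpow_enn _ hb0
      rw [← ENNReal.ofReal_one]
      exact ENNReal.ofReal_le_ofReal h.le
  calc _ ≤ ∫⁻ x in uI, ((Set.Icc (-1:ℝ) 1).indicator
            (fun y => (ENNReal.ofReal |y|) ^ (-b)) (x - c) + 1) := lintegral_mono fun x => key x
    _ = (∫⁻ x in uI, ((Set.Icc (-1:ℝ) 1).indicator
            (fun y => (ENNReal.ofReal |y|) ^ (-b)) (x - c))) + 1 := by
        rw [lintegral_add_right _ measurable_const]; simp [volume_uI]
    _ ≤ (∫⁻ x, ((Set.Icc (-1:ℝ) 1).indicator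
            (fun y => (ENNReal.ofReal |y|) ^ (-b)) (x - c))) + 1 := by
        exact add_le_add_left (setLIntegral_le_lintegral _ _) _
    _ = (∫⁻ x, ((Set.Icc (-1:ℝ) 1).indicator
            (fun y => (ENNReal.ofReal |y|) ^ (-b)) x)) + 1 := by
        rw [lintegral_sub_right_eq_self]
    _ ≤ ENNReal.ofReal (2 / (1 - b)) + ENNReal.ofReal 1 := by
        rw [lintegral_indicator measurableSet_Icc, ENNReal.ofReal_one]
        gcongr
        exact lint_pow_ball b hb0 hb
    _ ≤ _ := by
        rw [← ENNReal.ofReal_add (div_nonneg (by norm_num) (by linarith)) (by norm_num)]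
        apply ENNReal.ofReal_le_ofReal
        have h1 : 0 < 1 - b := by linarith
        rw [div_add_one h1.ne']
        gcongr
        linarith

lemma abs_sin_pi_ge (x : ℝ) (hx : |x| ≤ 1/2) : 2 * |x| ≤ |Real.sin (Real.pi * x)| := by
  have hpi := Real.pi_pos
  have h := Real.mul_abs_le_abs_sin (x := Real.pi * x) (by
    rw [abs_mul, abs_of_pos hpi]; nlinarith)
  rw [abs_mul, abs_of_pos hpi] at h
  calc 2 * |x| = 2 / Real.pi * (Real.pi * |x|) := by field_simp
    _ ≤ _ := h

lemma abs_sin_round (x : ℝ) : 2 * |x - round x| ≤ |Real.sin (Real.pi * x)| := by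
  have h := abs_sin_pi_ge (x - round x) (abs_sub_round x)
  have h2 : Real.sin (Real.pi * (x - round x)) = (-1) ^ (round x) * Real.sin (Real.pi * x) := by
    rw [mul_sub, mul_comm Real.pi (round x : ℝ), Real.sin_sub_int_mul_pi]
  rw [h2, abs_mul] at h
  simpa using h

lemma lint_sin (b : ℝ) (hb0 : 0 ≤ b) (hb : b < 1) (φ : ℝ) :
    ∫⁻ p in uI, (ENNReal.ofReal |Real.sin (Real.pi * (p - φ))|) ^ (-b)
      ≤ ENNReal.ofReal (9 / (1 - b)) := by
  set m : ℤ := round (-φ) with hm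
  have key : ∀ p ∈ uI, (ENNReal.ofReal |Real.sin (Real.pi * (p - φ))|) ^ (-b) ≤
      (ENNReal.ofReal |p - (φ + m - 1)|) ^ (-b) + (ENNReal.ofReal |p - (φ + m)|) ^ (-b)
      + (ENNReal.ofReal |p - (φ + m + 1)|) ^ (-b) := by
    intro p hp
    have h := abs_sin_round (p - φ)
    set k : ℤ := round (p - φ) with hk
    have h1 : |p - φ - k| ≤ 1/2 := abs_sub_round _
    have h2 : |-φ - m| ≤ 1/2 := abs_sub_round _
    have hp1 := hp.1
    have hp2 := hp.2
    rw [abs_le] at h1 h2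
    have h3 : k - m < 2 := by
      have : (k : ℝ) - m < 2 := by linarith
      exact_mod_cast this
    have h4 : -2 < k - m := by
      have : (-2 : ℝ) < (k : ℝ) - m := by linarith
      exact_mod_cast this
    have h5 : (ENNReal.ofReal |Real.sin (Real.pi * (p - φ))|) ^ (-b) ≤
        (ENNReal.ofReal |p - (φ + k)|) ^ (-b) := by
      apply rpow_anti _ hb0
      apply ENNReal.ofReal_le_ofReal
      have : p - (φ + k) = p - φ - k := by ring
      rw [this]
      have := abs_nonneg (p - φ - k)
      linarith
    refine h5.trans ?_
    have h6 : k = m - 1 ∨ k = m ∨ k = m + 1 := by omega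
    rcases h6 with h6 | h6 | h6
    · rw [h6]; push_cast
      rw [show φ + ((m:ℝ) - 1) = φ + m - 1 by ring, add_assoc]
      exact le_self_add
    · rw [h6]; rw [add_right_comm]; exact le_add_self
    · rw [h6]; push_cast
      rw [show φ + ((m:ℝ) + 1) = φ + m + 1 by ring]
      exact le_add_self
  calc _ ≤ ∫⁻ p in uI, ((ENNReal.ofReal |p - (φ + m - 1)|) ^ (-b)
      + (ENNReal.ofReal |p - (φ + m)|) ^ (-b)
      + (ENNReal.ofReal |p - (φ + m + 1)|) ^ (-b)) :=
        setLIntegral_mono' measurableSet_uI key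
    _ ≤ ENNReal.ofReal (3 / (1 - b)) + ENNReal.ofReal (3 / (1 - b))
        + ENNReal.ofReal (3 / (1 - b)) := by
        rw [lintegral_add_left (by fun_prop), lintegral_add_left (by fun_prop)]
        gcongr <;> exact lint_pow_shift b hb0 hb _
    _ = _ := by
        have h1 : 0 ≤ 3 / (1 - b) := div_nonneg (by norm_num) (by linarith)
        rw [← ENNReal.ofReal_add h1 h1, ← ENNReal.ofReal_add (by linarith) h1]
        congr 1; ring


def Ez (p : ℝ) : ℂ := Complex.exp (Complex.I * ((2 * Real.pi * p : ℝ) : ℂ))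

lemma Ez_norm (p : ℝ) : ‖Ez p‖ = 1 := by
  unfold Ez; rw [mul_comm]; exact Complex.norm_exp_ofReal_mul_I _

lemma root_factor (r : ℂ) : ∃ φ : ℝ, ∀ p : ℝ,
    |Real.sin (Real.pi * (p - φ))| * (1 + ‖r‖) ≤ 4 * ‖Ez p - r‖ := by
  have hpi := Real.pi_pos
  refine ⟨r.arg / (2 * Real.pi), fun p => ?_⟩
  set φ := r.arg / (2 * Real.pi) with hφ
  have hr : r = (‖r‖ : ℂ) * Ez φ := by
    conv_lhs => rw [← Complex.norm_mul_exp_arg_mul_I r]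
    unfold Ez
    rw [mul_comm Complex.I]
    congr 4
    rw [hφ]; field_simp
  have h1 : ‖Ez p - Ez φ‖ = 2 * |Real.sin (Real.pi * (p - φ))| := by
    have : Ez p - Ez φ = Ez φ * (Complex.exp (Complex.I * ((2 * Real.pi * (p - φ) : ℝ) : ℂ)) - 1) := by
      unfold Ez
      rw [mul_sub, ← Complex.exp_add, mul_one]
      congr 2
      push_cast; ring
    rw [this, norm_mul, Ez_norm, one_mul, Complex.norm_exp_I_mul_ofReal_sub_one, norm_mul,
      Real.norm_eq_abs, Real.norm_eq_abs, abs_two]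
    congr 3; ring
  have h2 : |‖r‖ - 1| ≤ ‖Ez p - r‖ := by
    have := abs_norm_sub_norm_le r (Ez p)
    rwa [Ez_norm, norm_sub_rev] at this
  have h3 : ‖r - Ez φ‖ = |‖r‖ - 1| := by
    have : r - Ez φ = ((‖r‖ - 1 : ℝ) : ℂ) * Ez φ := by
      nth_rewrite 1 [hr]; push_cast; ring
    rw [this, norm_mul, Ez_norm, mul_one, Complex.norm_real, Real.norm_eq_abs]
  have h4 : ‖Ez p - Ez φ‖ ≤ ‖Ez p - r‖ + ‖r - Ez φ‖ := by
    have := norm_add_le (Ez p - r) (r - Ez φ)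
    simpa using this
  have h5 := Real.abs_sin_le_one (Real.pi * (p - φ))
  have h6 := le_abs_self (‖r‖ - 1)
  have h7 := abs_nonneg (Real.sin (Real.pi * (p - φ)))
  have h8 := norm_nonneg r
  set S := |Real.sin (Real.pi * (p - φ))|
  set D := ‖Ez p - r‖
  have h9 : S ≤ D := by linarith
  by_cases hR : ‖r‖ ≤ 3
  · nlinarith
  · push Not at hR
    nlinarith

lemma multiset_prod_lower (z : ℂ) (μ : ℝ) (hμ : 0 ≤ μ) (s : Multiset ℂ)
    (h : ∀ r ∈ s, μ * (1 + ‖r‖) ≤ ‖z - r‖) :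
    μ ^ (Multiset.card s) * (s.map fun r => 1 + ‖r‖).prod ≤ ‖(s.map fun r => z - r).prod‖ := by
  induction s using Multiset.induction_on with
  | empty => simp
  | cons a s ih =>
    simp only [Multiset.map_cons, Multiset.prod_cons, Multiset.card_cons, norm_mul]
    have h1 := ih fun r hr => h r (Multiset.mem_cons_of_mem hr)
    have h2 := h a (Multiset.mem_cons_self a s)
    calc _ = (μ * (1 + ‖a‖)) * (μ ^ (Multiset.card s) * (s.map fun r => 1 + ‖r‖).prod) := by ring
      _ ≤ _ := by
        apply mul_le_mul h2 h1 _ (norm_nonneg _)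
        apply mul_nonneg (pow_nonneg hμ _)
        apply Multiset.prod_nonneg
        intro x hx
        obtain ⟨r, _, rfl⟩ := Multiset.mem_map.1 hx
        positivity

lemma multiset_prod_upper (z : ℂ) (hz : ‖z‖ = 1) (s : Multiset ℂ) :
    ‖(s.map fun r => z - r).prod‖ ≤ (s.map fun r => 1 + ‖r‖).prod := by
  induction s using Multiset.induction_on with
  | empty => simp
  | cons a s ih =>
    simp only [Multiset.map_cons, Multiset.prod_cons, norm_mul]
    apply mul_le_mul _ ih (norm_nonneg _) (by positivity)
    calc ‖z - a‖ ≤ ‖z‖ + ‖a‖ := norm_sub_le _ _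
      _ = _ := by rw [hz]

lemma poly_pointwise (n : ℕ) (P : Polynomial ℂ) (hP : P.natDegree ≤ n) (φ : ℂ → ℝ)
    (hφ : ∀ r : ℂ, ∀ p : ℝ, |Real.sin (Real.pi * (p - φ r))| * (1 + ‖r‖) ≤ 4 * ‖Ez p - r‖)
    (p p0 : ℝ) :
    ‖P.eval (Ez p0)‖ ≤ ‖P.eval (Ez p)‖ ∨ ∃ r ∈ P.roots.toFinset,
      (|Real.sin (Real.pi * (p - φ r))| / 4) ^ n * ‖P.eval (Ez p0)‖ ≤ ‖P.eval (Ez p)‖ := by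
  have hs : P.Splits := IsAlgClosed.splits P
  have hcard : Multiset.card P.roots ≤ n := (Polynomial.card_roots' P).trans hP
  have key : ∀ μ : ℝ, 0 ≤ μ → μ ≤ 1 → (∀ r ∈ P.roots, μ * (1 + ‖r‖) ≤ ‖Ez p - r‖) →
      μ ^ n * ‖P.eval (Ez p0)‖ ≤ ‖P.eval (Ez p)‖ := by
    intro μ h0 h1 h
    have a1 := multiset_prod_lower (Ez p) μ h0 P.roots h
    have a2 := multiset_prod_upper (Ez p0) (Ez_norm p0) P.roots
    rw [hs.eval_eq_prod_roots, hs.eval_eq_prod_roots, norm_mul, norm_mul]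
    have a3 : μ ^ n ≤ μ ^ (Multiset.card P.roots) := pow_le_pow_of_le_one h0 h1 hcard
    calc _ ≤ μ ^ n * (‖P.leadingCoeff‖ * (P.roots.map fun r => 1 + ‖r‖).prod) := by gcongr
      _ = ‖P.leadingCoeff‖ * (μ ^ n * (P.roots.map fun r => 1 + ‖r‖).prod) := by ring
      _ ≤ ‖P.leadingCoeff‖ * (μ ^ (Multiset.card P.roots) * (P.roots.map fun r => 1 + ‖r‖).prod) := by
          have : 0 ≤ (P.roots.map fun r => 1 + ‖r‖).prod := (norm_nonneg _).trans a2
          gcongr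
      _ ≤ _ := by gcongr
  by_cases he : P.roots.toFinset.Nonempty
  · right
    obtain ⟨r, hr, hmin⟩ := Finset.exists_min_image P.roots.toFinset
      (fun r => |Real.sin (Real.pi * (p - φ r))|) he
    refine ⟨r, hr, key _ (by positivity) ?_ ?_⟩
    · have := Real.abs_sin_le_one (Real.pi * (p - φ r)); linarith
    · intro r' hr'
      have h1 := hmin r' (Multiset.mem_toFinset.2 hr')
      have h2 := hφ r' p
      have h3 := norm_nonneg r'
      nlinarith
  · left
    have : P.roots = 0 := by
      rw [Finset.not_nonempty_iff_eq_empty, Multiset.toFinset_eq_empty] at he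
      exact he
    have := key 1 zero_le_one le_rfl (by simp [this])
    simpa using this

lemma poly_moment (n : ℕ) (hn : 1 ≤ n) (P : Polynomial ℂ) (hP : P.natDegree ≤ n)
    (b : ℝ) (hb0 : 0 ≤ b) (hb : b < 1) (p0 : ℝ) :
    ∫⁻ p in uI, (ENNReal.ofReal ‖P.eval (Ez p)‖) ^ (-(b / n)) ≤
      ENNReal.ofReal ((1 + 36 * n) / (1 - b)) * (ENNReal.ofReal ‖P.eval (Ez p0)‖) ^ (-(b / n)) := by
  choose φ hφ using root_factor
  have hn0 : (0:ℝ) < n := by exact_mod_cast hn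
  set N0 := (ENNReal.ofReal ‖P.eval (Ez p0)‖) ^ (-(b / n)) with hN0
  have h1b : 0 < 1 - b := by linarith
  have key : ∀ p, (ENNReal.ofReal ‖P.eval (Ez p)‖) ^ (-(b / n)) ≤
      N0 * (1 + ∑ r ∈ P.roots.toFinset,
        4 * (ENNReal.ofReal |Real.sin (Real.pi * (p - φ r))|) ^ (-b)) := by
    intro p
    rcases poly_pointwise n P hP φ hφ p p0 with h | ⟨r, hr, h⟩
    · calc _ ≤ N0 := rpow_anti _ (by positivity) (ENNReal.ofReal_le_ofReal h)
        _ = N0 * 1 := (mul_one _).symm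
        _ ≤ _ := by gcongr; exact le_self_add
    · calc _ ≤ (ENNReal.ofReal ((|Real.sin (Real.pi * (p - φ r))| / 4) ^ n
              * ‖P.eval (Ez p0)‖)) ^ (-(b / n)) :=
            rpow_anti _ (by positivity) (ENNReal.ofReal_le_ofReal h)
        _ = N0 * (ENNReal.ofReal (|Real.sin (Real.pi * (p - φ r))| / 4)) ^ (-b) := by
            rw [ENNReal.ofReal_mul (by positivity), ENNReal.mul_rpow_of_ne_top (by simp) (by simp),
              mul_comm, ENNReal.ofReal_pow (by positivity), ← ENNReal.rpow_natCast,
              ← ENNReal.rpow_mul]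
            congr 2; field_simp
        _ ≤ N0 * (4 * (ENNReal.ofReal |Real.sin (Real.pi * (p - φ r))|) ^ (-b)) := by
            gcongr
            rw [div_eq_mul_inv, ENNReal.ofReal_mul (by positivity),
              ENNReal.mul_rpow_of_ne_top (by simp) (by simp), mul_comm]
            gcongr
            rw [ENNReal.ofReal_rpow_of_pos (by norm_num), Real.rpow_neg (by norm_num),
              Real.inv_rpow (by norm_num), inv_inv]
            calc ENNReal.ofReal (4 ^ b) ≤ ENNReal.ofReal ((4:ℝ) ^ (1:ℝ)) :=
                  ENNReal.ofReal_le_ofReal (Real.rpow_le_rpow_of_exponent_le (by norm_num) hb.le)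
              _ = 4 := by simp
        _ ≤ _ := by
            gcongr
            refine le_trans ?_ le_add_self
            exact Finset.single_le_sum (f := fun r => 4 * (ENNReal.ofReal |Real.sin (Real.pi * (p - φ r))|) ^ (-b))
              (fun _ _ => zero_le) hr
  have hm : ∀ r : ℂ, Measurable fun p : ℝ =>
      4 * (ENNReal.ofReal |Real.sin (Real.pi * (p - φ r))|) ^ (-b) := by
    intro r; fun_prop
  calc _ ≤ ∫⁻ p in uI, N0 * (1 + ∑ r ∈ P.roots.toFinset,
        4 * (ENNReal.ofReal |Real.sin (Real.pi * (p - φ r))|) ^ (-b)) :=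
        lintegral_mono fun p => key p
    _ = N0 * (1 + ∑ r ∈ P.roots.toFinset, 4 * ∫⁻ p in uI,
        (ENNReal.ofReal |Real.sin (Real.pi * (p - φ r))|) ^ (-b)) := by
        rw [lintegral_const_mul _ (by
          exact measurable_const.add (Finset.measurable_fun_sum _ fun r _ => hm r))]
        rw [lintegral_add_left measurable_const, lintegral_finsetSum _ fun r _ => hm r]
        congr 2
        · simp [volume_uI]
        · apply Finset.sum_congr rfl
          intro r _
          rw [lintegral_const_mul _ (by fun_prop)]
    _ ≤ N0 * (1 + ∑ r ∈ P.roots.toFinset, 4 * ENNReal.ofReal (9 / (1 - b))) := by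
        gcongr with r hr
        exact lint_sin b hb0 hb _
    _ ≤ N0 * ENNReal.ofReal ((1 + 36 * n) / (1 - b)) := by
        gcongr
        rw [Finset.sum_const, nsmul_eq_mul]
        have hc : (P.roots.toFinset.card : ENNReal) ≤ (n : ENNReal) := by
          exact_mod_cast (Multiset.toFinset_card_le _).trans ((Polynomial.card_roots' P).trans hP)
        calc 1 + (P.roots.toFinset.card : ENNReal) * (4 * ENNReal.ofReal (9 / (1 - b)))
            ≤ 1 + (n : ENNReal) * (4 * ENNReal.ofReal (9 / (1 - b))) := by gcongr
          _ = ENNReal.ofReal (1 + n * (4 * (9 / (1 - b)))) := by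
              rw [ENNReal.ofReal_add (by norm_num) (by positivity),
                ENNReal.ofReal_mul (by positivity), ENNReal.ofReal_mul (by positivity)]
              simp
          _ ≤ _ := by
              apply ENNReal.ofReal_le_ofReal
              rw [add_div]
              gcongr
              · rw [le_div_iff₀ h1b]; linarith
              · apply le_of_eq; ring
    _ = _ := mul_comm _ _

/-- moments of trigonometric polynomials of degree two -/
lemma trig2_moment (u0 u1 u2 u3 u4 u5 : ℝ) (g : ℝ → ℝ)
    (hg : ∀ p, g p = u0 + u1 * Real.cos (2 * Real.pi * p) + u2 * Real.sin (2 * Real.pi * p)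
      + u3 * Real.cos (2 * Real.pi * p) ^ 2
      + u4 * (Real.cos (2 * Real.pi * p) * Real.sin (2 * Real.pi * p))
      + u5 * Real.sin (2 * Real.pi * p) ^ 2)
    (b : ℝ) (hb0 : 0 ≤ b) (hb : b < 1) (p0 : ℝ) :
    ∫⁻ p in uI, (ENNReal.ofReal |g p|) ^ (-(b / 4)) ≤
      ENNReal.ofReal (145 / (1 - b)) * (ENNReal.ofReal |g p0|) ^ (-(b / 4)) := by
  set P : Polynomial ℂ := Polynomial.C (u0 : ℂ) * Polynomial.X ^ 2
    + Polynomial.C ((u1 : ℂ) / 2) * (Polynomial.X ^ 3 + Polynomial.X)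
    + Polynomial.C (-(u2 : ℂ) * Complex.I / 2) * (Polynomial.X ^ 3 - Polynomial.X)
    + Polynomial.C ((u3 : ℂ) / 4) * (Polynomial.X ^ 4 + 2 * Polynomial.X ^ 2 + 1)
    + Polynomial.C (-(u4 : ℂ) * Complex.I / 4) * (Polynomial.X ^ 4 - 1)
    + Polynomial.C (-(u5 : ℂ) / 4) * (Polynomial.X ^ 4 - 2 * Polynomial.X ^ 2 + 1) with hPdef
  have hdeg : P.natDegree ≤ 4 := by rw [hPdef]; compute_degree
  have hval : ∀ p, ‖P.eval (Ez p)‖ = |g p| := by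
    intro p
    have hz : Ez p = (Real.cos (2 * Real.pi * p) : ℂ) + (Real.sin (2 * Real.pi * p) : ℂ) * Complex.I := by
      unfold Ez; rw [mul_comm, Complex.exp_mul_I]; simp
    have hcs : (Real.cos (2 * Real.pi * p) : ℂ) ^ 2 + (Real.sin (2 * Real.pi * p) : ℂ) ^ 2 = 1 := by
      exact_mod_cast Real.cos_sq_add_sin_sq (2 * Real.pi * p)
    have hgc : (g p : ℂ) = u0 + u1 * (Real.cos (2 * Real.pi * p) : ℂ) + u2 * (Real.sin (2 * Real.pi * p) : ℂ)
      + u3 * (Real.cos (2 * Real.pi * p) : ℂ) ^ 2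
      + u4 * ((Real.cos (2 * Real.pi * p) : ℂ) * (Real.sin (2 * Real.pi * p) : ℂ))
      + u5 * (Real.sin (2 * Real.pi * p) : ℂ) ^ 2 := by rw [hg p]; push_cast; ring
    have hE : P.eval (Ez p) = Ez p ^ 2 * (g p : ℂ) := by
      rw [hgc]
      set c := (Real.cos (2 * Real.pi * p) : ℂ)
      set s := (Real.sin (2 * Real.pi * p) : ℂ)
      set z := Ez p
      have hI := Complex.I_sq
      have e1 : z ^ 2 + 1 = 2 * (z * c) := by
        rw [hz]; linear_combination (-1 : ℂ) * hcs + s ^ 2 * hI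
      have e2 : z ^ 2 - 1 = 2 * Complex.I * (z * s) := by
        rw [hz]; linear_combination hcs - s ^ 2 * hI
      rw [hPdef]
      simp only [Polynomial.eval_add, Polynomial.eval_mul, Polynomial.eval_C, Polynomial.eval_pow,
        Polynomial.eval_X, Polynomial.eval_sub, Polynomial.eval_one, Polynomial.eval_ofNat]
      have f1 : z ^ 3 + z = z * (2 * (z * c)) := by rw [← e1]; ring
      have f2 : z ^ 3 - z = z * (2 * Complex.I * (z * s)) := by rw [← e2]; ring
      have f3 : z ^ 4 + 2 * z ^ 2 + 1 = (2 * (z * c)) ^ 2 := by rw [← e1]; ring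
      have f4 : z ^ 4 - 1 = (2 * (z * c)) * (2 * Complex.I * (z * s)) := by rw [← e1, ← e2]; ring
      have f5 : z ^ 4 - 2 * z ^ 2 + 1 = (2 * Complex.I * (z * s)) ^ 2 := by rw [← e2]; ring
      rw [f1, f2, f3, f4, f5]
      linear_combination (-(u2:ℂ) * z ^ 2 * s - u4 * z ^ 2 * c * s - u5 * z ^ 2 * s ^ 2) * hI
    rw [hE, norm_mul, norm_pow, Ez_norm, Complex.norm_real, Real.norm_eq_abs]; simp
  have := poly_moment 4 (by norm_num) P hdeg b hb0 hb p0
  simp only [hval] at this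
  norm_num at this
  exact this

/-- moments of trigonometric polynomials of degree one -/
lemma trig1_moment (u0 u1 u2 : ℝ) (g : ℝ → ℝ)
    (hg : ∀ p, g p = u0 + u1 * Real.cos (2 * Real.pi * p) + u2 * Real.sin (2 * Real.pi * p))
    (b : ℝ) (hb0 : 0 ≤ b) (hb : b < 1) (p0 : ℝ) :
    ∫⁻ p in uI, (ENNReal.ofReal |g p|) ^ (-(b / 2)) ≤
      ENNReal.ofReal (73 / (1 - b)) * (ENNReal.ofReal |g p0|) ^ (-(b / 2)) := by
  set P : Polynomial ℂ := Polynomial.C (u0 : ℂ) * Polynomial.X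
    + Polynomial.C ((u1 : ℂ) / 2) * (Polynomial.X ^ 2 + 1)
    + Polynomial.C (-(u2 : ℂ) * Complex.I / 2) * (Polynomial.X ^ 2 - 1) with hPdef
  have hdeg : P.natDegree ≤ 2 := by rw [hPdef]; compute_degree
  have hval : ∀ p, ‖P.eval (Ez p)‖ = |g p| := by
    intro p
    have hz : Ez p = (Real.cos (2 * Real.pi * p) : ℂ) + (Real.sin (2 * Real.pi * p) : ℂ) * Complex.I := by
      unfold Ez; rw [mul_comm, Complex.exp_mul_I]; simp
    have hcs : (Real.cos (2 * Real.pi * p) : ℂ) ^ 2 + (Real.sin (2 * Real.pi * p) : ℂ) ^ 2 = 1 := by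
      exact_mod_cast Real.cos_sq_add_sin_sq (2 * Real.pi * p)
    have hgc : (g p : ℂ) = u0 + u1 * (Real.cos (2 * Real.pi * p) : ℂ)
        + u2 * (Real.sin (2 * Real.pi * p) : ℂ) := by rw [hg p]; push_cast; ring
    have hE : P.eval (Ez p) = Ez p * (g p : ℂ) := by
      rw [hgc]
      set c := (Real.cos (2 * Real.pi * p) : ℂ)
      set s := (Real.sin (2 * Real.pi * p) : ℂ)
      set z := Ez p
      have hI := Complex.I_sq
      have e1 : z ^ 2 + 1 = 2 * (z * c) := by
        rw [hz]; linear_combination (-1 : ℂ) * hcs + s ^ 2 * hI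
      have e2 : z ^ 2 - 1 = 2 * Complex.I * (z * s) := by
        rw [hz]; linear_combination hcs - s ^ 2 * hI
      rw [hPdef]
      simp only [Polynomial.eval_add, Polynomial.eval_mul, Polynomial.eval_C, Polynomial.eval_pow,
        Polynomial.eval_X, Polynomial.eval_sub, Polynomial.eval_one]
      rw [e1, e2]
      linear_combination (-(u2:ℂ) * z * s) * hI
    rw [hE, norm_mul, Ez_norm, Complex.norm_real, Real.norm_eq_abs]; simp
  have := poly_moment 2 (by norm_num) P hdeg b hb0 hb p0
  simp only [hval] at this
  norm_num at this
  exact this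


lemma cos_diff_lower {x y ρ : ℝ} (hx : 0 ≤ x) (hxy : x ≤ y) (hy : y ≤ Real.pi)
    (h1 : ρ ≤ Real.sin x) (h2 : ρ ≤ Real.sin y) :
    ρ * (y - x) * (2 / Real.pi) ≤ Real.cos x - Real.cos y ∧
    2 * ((y - x) / Real.pi) ^ 2 ≤ Real.cos x - Real.cos y := by
  have hpi := Real.pi_pos
  set m := (x + y) / 2 with hm
  set h := (y - x) / 2 with hh
  have ex : x = m - h := by rw [hm, hh]; ring
  have ey : y = m + h := by rw [hm, hh]; ring
  have e1 : Real.cos x - Real.cos y = 2 * (Real.sin m * Real.sin h) := by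
    rw [ex, ey, Real.cos_sub, Real.cos_add]; ring
  have e2 : Real.sin x + Real.sin y = 2 * (Real.sin m * Real.cos h) := by
    rw [ex, ey, Real.sin_sub, Real.sin_add]; ring
  have h0 : 0 ≤ h := by rw [hh]; linarith
  have hle : h ≤ Real.pi / 2 := by rw [hh]; linarith
  have e3 := Real.mul_le_sin h0 hle
  have sm : 0 ≤ Real.sin m := Real.sin_nonneg_of_nonneg_of_le_pi (by rw [hm]; linarith) (by rw [hm]; linarith)
  have e4 : ρ ≤ Real.sin m := by
    have := Real.cos_le_one h
    nlinarith
  have e5 : Real.sin h ≤ Real.sin m := by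
    have : Real.sin m - Real.sin h = 2 * (Real.sin (x / 2) * Real.cos (y / 2)) := by
      rw [Real.sin_sub_sin]; rw [hm, hh]
      rw [show ((x + y) / 2 - (y - x) / 2) / 2 = x / 2 by ring,
        show ((x + y) / 2 + (y - x) / 2) / 2 = y / 2 by ring]; ring
    have a1 : 0 ≤ Real.sin (x / 2) := Real.sin_nonneg_of_nonneg_of_le_pi (by linarith) (by linarith)
    have a2 : 0 ≤ Real.cos (y / 2) := Real.cos_nonneg_of_mem_Icc ⟨by linarith, by linarith⟩
    have := mul_nonneg a1 a2
    linarith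
  have e6 : 0 ≤ 2 / Real.pi * h := by positivity
  have e7 : 2 / Real.pi * h = (y - x) / Real.pi := by rw [hh]; field_simp
  constructor
  · rw [e1]
    have : ρ * (y - x) * (2 / Real.pi) = 2 * (ρ * (2 / Real.pi * h)) := by rw [hh]; ring
    rw [this]
    have := mul_le_mul e4 e3 e6 sm
    linarith
  · rw [e1, ← e7]
    have := mul_le_mul (e3.trans e5) e3 e6 sm
    nlinarith

lemma cell_diff {x y ρ : ℝ} (k : ℤ) (hx : k * Real.pi ≤ x) (hx' : x ≤ (k + 1) * Real.pi)
    (hy : k * Real.pi ≤ y) (hy' : y ≤ (k + 1) * Real.pi)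
    (h1 : ρ ≤ |Real.sin x|) (h2 : ρ ≤ |Real.sin y|) :
    ρ * |y - x| * (2 / Real.pi) ≤ |Real.cos x - Real.cos y| ∧
    2 * (|y - x| / Real.pi) ^ 2 ≤ |Real.cos x - Real.cos y| := by
  wlog hxy : x ≤ y with H
  · have := H k hy hy' hx hx' h2 h1 (le_of_not_ge hxy)
    rwa [abs_sub_comm x y, abs_sub_comm (Real.cos y)] at this
  have s1 : ∀ z, k * Real.pi ≤ z → z ≤ (k + 1) * Real.pi → |Real.sin z| = Real.sin (z - k * Real.pi) := by
    intro z hz hz'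
    have : 0 ≤ Real.sin (z - k * Real.pi) :=
      Real.sin_nonneg_of_nonneg_of_le_pi (by linarith) (by linarith)
    rw [← abs_of_nonneg this, Real.sin_sub_int_mul_pi, abs_mul]; simp
  have s2 : |Real.cos x - Real.cos y| = |Real.cos (x - k * Real.pi) - Real.cos (y - k * Real.pi)| := by
    rw [Real.cos_sub_int_mul_pi, Real.cos_sub_int_mul_pi, ← mul_sub, abs_mul]; simp
  rw [s1 x hx hx'] at h1
  rw [s1 y hy hy'] at h2
  have := cos_diff_lower (x := x - k * Real.pi) (y := y - k * Real.pi) (by linarith) (by linarith)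
    (by linarith) h1 h2
  rw [sub_sub_sub_cancel_right] at this
  rw [s2, abs_of_nonneg (sub_nonneg.2 hxy)]
  exact ⟨this.1.trans (le_abs_self _), this.2.trans (le_abs_self _)⟩

lemma volume_three_cells (S : Set ℝ) (hS : S ⊆ uI) (Q d : ℝ)
    (h : ∀ k : ℤ, ∀ p ∈ S, ∀ p' ∈ S, k * Real.pi ≤ 2 * Real.pi * p + Q →
      2 * Real.pi * p + Q ≤ (k + 1) * Real.pi → k * Real.pi ≤ 2 * Real.pi * p' + Q →
      2 * Real.pi * p' + Q ≤ (k + 1) * Real.pi → |p' - p| ≤ d) :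
    volume S ≤ ENNReal.ofReal (3 * d) := by
  have hpi := Real.pi_pos
  set cell : ℤ → Set ℝ := fun k => {p ∈ S | k * Real.pi ≤ 2 * Real.pi * p + Q ∧
    2 * Real.pi * p + Q ≤ (k + 1) * Real.pi} with hcell
  have hv : ∀ k, volume (cell k) ≤ ENNReal.ofReal d := by
    intro k
    refine (Real.volume_le_diam _).trans (Metric.ediam_le ?_)
    intro p hp p' hp'
    rw [edist_comm, edist_dist, Real.dist_eq]
    exact ENNReal.ofReal_le_ofReal (h k p hp.1 p' hp'.1 hp.2.1 hp.2.2 hp'.2.1 hp'.2.2)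
  set m : ℤ := ⌊Q / Real.pi⌋ with hm
  have hsub : S ⊆ cell (m - 1) ∪ cell m ∪ cell (m + 1) := by
    intro p hp
    have hp1 := (hS hp).1
    have hp2 := (hS hp).2
    set k : ℤ := ⌊(2 * Real.pi * p + Q) / Real.pi⌋ with hk
    have a1 : (k : ℝ) ≤ (2 * Real.pi * p + Q) / Real.pi := Int.floor_le _
    have a2 : (2 * Real.pi * p + Q) / Real.pi < k + 1 := Int.lt_floor_add_one _
    have b1 : (m : ℝ) ≤ Q / Real.pi := Int.floor_le _
    have b2 : Q / Real.pi < m + 1 := Int.lt_floor_add_one _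
    have e : (2 * Real.pi * p + Q) / Real.pi = 2 * p + Q / Real.pi := by field_simp
    have hin : p ∈ cell k := by
      refine ⟨hp, ?_, ?_⟩
      · rwa [le_div_iff₀ hpi] at a1
      · rw [div_lt_iff₀ hpi] at a2; exact a2.le
    rw [e] at a1 a2
    have c1 : k < m + 2 := by
      have : (k:ℝ) < m + 2 := by linarith
      exact_mod_cast this
    have c2 : m - 2 < k := by
      have : (m:ℝ) - 2 < k := by linarith
      exact_mod_cast this
    have : k = m - 1 ∨ k = m ∨ k = m + 1 := by omega
    rcases this with h | h | h
    · left; left; rw [← h]; exact hin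
    · left; right; rw [← h]; exact hin
    · right; rw [← h]; exact hin
  calc volume S ≤ volume (cell (m - 1) ∪ cell m ∪ cell (m + 1)) := measure_mono hsub
    _ ≤ volume (cell (m - 1)) + volume (cell m) + volume (cell (m + 1)) :=
      (measure_union_le _ _).trans (by gcongr; exact measure_union_le _ _)
    _ ≤ ENNReal.ofReal d + ENNReal.ofReal d + ENNReal.ofReal d := by gcongr <;> exact hv _
    _ ≤ _ := by
      by_cases hd : 0 ≤ d
      · rw [← ENNReal.ofReal_add hd hd, ← ENNReal.ofReal_add (by linarith) hd]
        apply ENNReal.ofReal_le_ofReal; linarith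
      · simp [ENNReal.ofReal_of_nonpos (le_of_not_ge hd)]

lemma volume_slab (Q X t ρ : ℝ) (ht : 0 < t) (hρ : 0 < ρ) :
    volume {p ∈ uI | |Real.cos (2 * Real.pi * p + Q) - X| ≤ t ∧ ρ ≤ |Real.sin (2 * Real.pi * p + Q)|}
      ≤ ENNReal.ofReal (3 / 2 * (t / ρ)) := by
  have hpi := Real.pi_pos
  have := volume_three_cells {p ∈ uI | |Real.cos (2 * Real.pi * p + Q) - X| ≤ t ∧
    ρ ≤ |Real.sin (2 * Real.pi * p + Q)|} (fun p hp => hp.1) Q (t / ρ / 2) ?_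
  · convert this using 2; ring
  intro k p hp p' hp' h1 h2 h3 h4
  have := (cell_diff k h1 h2 h3 h4 hp.2.2 hp'.2.2).1
  have h5 : |Real.cos (2 * Real.pi * p + Q) - Real.cos (2 * Real.pi * p' + Q)| ≤ 2 * t := by
    have a := abs_le.1 hp.2.1
    have b := abs_le.1 hp'.2.1
    rw [abs_le]; constructor <;> linarith
  have e : 2 * Real.pi * p' + Q - (2 * Real.pi * p + Q) = 2 * Real.pi * (p' - p) := by ring
  rw [e, abs_mul, abs_of_pos (by positivity : 0 < 2 * Real.pi)] at this
  have e2 : ρ * (2 * Real.pi * |p' - p|) * (2 / Real.pi) = 4 * (ρ * |p' - p|) := by field_simp; ring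
  rw [e2] at this
  rw [div_div, le_div_iff₀ (by positivity)]
  linarith

lemma volume_slab_sqrt (Q X t : ℝ) (ht : 0 < t) :
    volume {p ∈ uI | |Real.cos (2 * Real.pi * p + Q) - X| ≤ t}
      ≤ ENNReal.ofReal (3 / 2 * √t) := by
  have hpi := Real.pi_pos
  have := volume_three_cells {p ∈ uI | |Real.cos (2 * Real.pi * p + Q) - X| ≤ t}
     (fun p hp => hp.1) Q (√t / 2) ?_
  · convert this using 2; ring
  intro k p hp p' hp' h1 h2 h3 h4
  have := (cell_diff k h1 h2 h3 h4 (abs_nonneg _) (abs_nonneg _)).2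
  have h5 : |Real.cos (2 * Real.pi * p + Q) - Real.cos (2 * Real.pi * p' + Q)| ≤ 2 * t := by
    have a := abs_le.1 hp.2
    have b := abs_le.1 hp'.2
    rw [abs_le]; constructor <;> linarith
  have e : 2 * Real.pi * p' + Q - (2 * Real.pi * p + Q) = 2 * Real.pi * (p' - p) := by ring
  rw [e, abs_mul, abs_of_pos (by positivity : 0 < 2 * Real.pi)] at this
  have e2 : 2 * Real.pi * |p' - p| / Real.pi = 2 * |p' - p| := by field_simp
  rw [e2] at this
  have : 2 * |p' - p| ≤ √t := Real.le_sqrt_of_sq_le (by linarith)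
  linarith

lemma min_one_le_rpow {x : ENNReal} {a : ℝ} (h0 : 0 ≤ a) (h1 : a ≤ 1) : min 1 x ≤ x ^ a := by
  rcases le_total x 1 with h | h
  · rw [min_eq_right h]
    calc x = x ^ (1:ℝ) := by simp
      _ ≤ x ^ a := ENNReal.rpow_le_rpow_of_exponent_ge h h1
  · rw [min_eq_left h]
    exact one_le_rpow_enn h h0

/-- the discriminant of the ellipse constraint -/
def Gd (Q X Y : ℝ) : ℝ := X ^ 2 + Y ^ 2 - 2 * X * Y * Real.cos Q - Real.sin Q ^ 2

lemma Gd_bound (Q θ X Y t : ℝ) (hX : |Real.cos θ - X| ≤ t)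
    (hY : |Real.cos (θ + Q) - Y| ≤ t) :
    |Gd Q X Y| ≤ 4 * t * |Real.sin Q| * max |Real.sin θ| |Real.sin (θ + Q)| + 4 * t ^ 2 := by
  set ρ := max |Real.sin θ| |Real.sin (θ + Q)| with hρ
  have ht : 0 ≤ t := (abs_nonneg _).trans hX
  obtain ⟨x, hx⟩ : ∃ x, X = Real.cos θ + x := ⟨X - Real.cos θ, by ring⟩
  obtain ⟨y, hy⟩ : ∃ y, Y = Real.cos (θ + Q) + y := ⟨Y - Real.cos (θ + Q), by ring⟩
  have hx' : |x| ≤ t := by rw [hx] at hX; simpa using hX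
  have hy' : |y| ≤ t := by rw [hy] at hY; simpa using hY
  have e : Gd Q X Y = 2 * (x * Real.sin (θ + Q) * Real.sin Q) - 2 * (y * Real.sin θ * Real.sin Q)
      + (x ^ 2 + y ^ 2 - 2 * (x * y * Real.cos Q)) := by
    rw [hx, hy, Gd, Real.cos_add, Real.sin_add]
    have h1 := Real.sin_sq_add_cos_sq θ
    have h2 := Real.sin_sq_add_cos_sq Q
    set s := Real.sin θ
    set c := Real.cos θ
    set S := Real.sin Q
    set C := Real.cos Q
    have hs : s ^ 2 = 1 - c ^ 2 := by linarith
    have hS : S ^ 2 = 1 - C ^ 2 := by linarith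
    ring_nf
    simp only [hs, hS]
    ring_nf
  have b1 : |x * Real.sin (θ + Q) * Real.sin Q| ≤ t * ρ * |Real.sin Q| := by
    rw [abs_mul, abs_mul]; gcongr; exact le_max_right _ _
  have b2 : |y * Real.sin θ * Real.sin Q| ≤ t * ρ * |Real.sin Q| := by
    rw [abs_mul, abs_mul]; gcongr; exact le_max_left _ _
  have b3 : |x * y * Real.cos Q| ≤ t * t * 1 := by
    rw [abs_mul, abs_mul]; gcongr; exact Real.abs_cos_le_one _
  have b4 : x ^ 2 ≤ t ^ 2 := sq_le_sq' (by linarith [(abs_le.1 hx').1]) (abs_le.1 hx').2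
  have b5 : y ^ 2 ≤ t ^ 2 := sq_le_sq' (by linarith [(abs_le.1 hy').1]) (abs_le.1 hy').2
  rw [abs_le] at b1 b2 b3
  rw [e, abs_le]
  have := sq_nonneg x
  have := sq_nonneg y
  constructor <;> nlinarith

lemma rho_lower (Q θ : ℝ) : |Real.sin Q| / 2 ≤ max |Real.sin θ| |Real.sin (θ + Q)| := by
  have e : Real.sin Q = Real.sin (θ + Q) * Real.cos θ - Real.cos (θ + Q) * Real.sin θ := by
    rw [← Real.sin_sub]; ring_nf
  have b1 : |Real.sin (θ + Q) * Real.cos θ| ≤ max |Real.sin θ| |Real.sin (θ + Q)| := by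
    rw [abs_mul]
    have := Real.abs_cos_le_one θ
    calc _ ≤ |Real.sin (θ + Q)| * 1 := by gcongr
      _ ≤ _ := by rw [mul_one]; exact le_max_right _ _
  have b2 : |Real.cos (θ + Q) * Real.sin θ| ≤ max |Real.sin θ| |Real.sin (θ + Q)| := by
    rw [abs_mul]
    have := Real.abs_cos_le_one (θ + Q)
    calc _ ≤ 1 * |Real.sin θ| := by gcongr
      _ ≤ _ := by rw [one_mul]; exact le_max_left _ _
  have := abs_sub (Real.sin (θ + Q) * Real.cos θ) (Real.cos (θ + Q) * Real.sin θ)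
  rw [← e] at this
  linarith

lemma volume_double (Q X Y t : ℝ) (ht : 0 < t) (hQ : t ≤ Real.sin Q ^ 2) (a : ℝ) (ha0 : 0 ≤ a)
    (ha1 : a ≤ 1) :
    volume {p ∈ uI | |Real.cos (2 * Real.pi * p) - X| ≤ t ∧
        |Real.cos (2 * Real.pi * p + Q) - Y| ≤ t}
      ≤ ENNReal.ofReal (36 * (t / |Real.sin Q|)) *
        (ENNReal.ofReal (t * Real.sin Q ^ 2) / ENNReal.ofReal |Gd Q X Y|) ^ a := by
  set δ := |Real.sin Q| with hδ
  have hδ2 : Real.sin Q ^ 2 = δ ^ 2 := (sq_abs _).symm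
  rw [hδ2] at hQ ⊢
  have hδ0 : 0 < δ := by
    rcases (abs_nonneg (Real.sin Q)).lt_or_eq with h | h
    · exact h
    · rw [hδ, ← h] at hQ; norm_num at hQ; linarith
  set G := |Gd Q X Y| with hG
  have hG0 : 0 ≤ G := abs_nonneg _
  set ρ0 := max (δ / 2) (G / (12 * t * δ)) with hρ0
  have hρpos : 0 < ρ0 := lt_of_lt_of_le (by positivity) (le_max_left _ _)
  have hsub : {p ∈ uI | |Real.cos (2 * Real.pi * p) - X| ≤ t ∧
        |Real.cos (2 * Real.pi * p + Q) - Y| ≤ t} ⊆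
      {p ∈ uI | |Real.cos (2 * Real.pi * p + 0) - X| ≤ t ∧ ρ0 ≤ |Real.sin (2 * Real.pi * p + 0)|} ∪
      {p ∈ uI | |Real.cos (2 * Real.pi * p + Q) - Y| ≤ t ∧ ρ0 ≤ |Real.sin (2 * Real.pi * p + Q)|} := by
    rintro p ⟨hp, h1, h2⟩
    have g1 := Gd_bound Q _ X Y t h1 h2
    have g2 := rho_lower Q (2 * Real.pi * p)
    have g3 : ρ0 ≤ max |Real.sin (2 * Real.pi * p)| |Real.sin (2 * Real.pi * p + Q)| := by
      rw [hρ0]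
      refine max_le g2 ?_
      rw [div_le_iff₀ (by positivity)]
      rw [← hδ, ← hG] at g1
      rw [← hδ] at g2
      set ρ := max |Real.sin (2 * Real.pi * p)| |Real.sin (2 * Real.pi * p + Q)|
      have : t ≤ 2 * δ * ρ := by nlinarith
      nlinarith
    rcases le_max_iff.1 g3 with h | h
    · left; refine ⟨hp, ?_, ?_⟩ <;> simpa
    · right; exact ⟨hp, h2, h⟩
  have hvol : volume {p ∈ uI | |Real.cos (2 * Real.pi * p) - X| ≤ t ∧
        |Real.cos (2 * Real.pi * p + Q) - Y| ≤ t} ≤ ENNReal.ofReal (3 * (t / ρ0)) := by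
    refine (measure_mono hsub).trans ((measure_union_le _ _).trans ?_)
    refine (add_le_add (volume_slab 0 X t ρ0 ht hρpos) (volume_slab Q Y t ρ0 ht hρpos)).trans ?_
    rw [← ENNReal.ofReal_add (by positivity) (by positivity)]
    apply ENNReal.ofReal_le_ofReal; linarith
  refine hvol.trans ?_
  calc ENNReal.ofReal (3 * (t / ρ0)) ≤ ENNReal.ofReal (36 * (t / δ)) *
        min 1 (ENNReal.ofReal (t * δ ^ 2) / ENNReal.ofReal G) := by
        rcases hG0.lt_or_eq with hGp | hGz
        · rw [← ENNReal.ofReal_div_of_pos hGp, ← ENNReal.ofReal_one, ← ENNReal.ofReal_min,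
            ← ENNReal.ofReal_mul (by positivity)]
          apply ENNReal.ofReal_le_ofReal
          rw [mul_min_of_nonneg _ _ (by positivity)]
          refine le_min ?_ ?_
          · have : t / ρ0 ≤ t / (δ / 2) := by gcongr; exact le_max_left _ _
            have e : t / (δ / 2) = 2 * (t / δ) := by field_simp
            have : 0 ≤ t / δ := by positivity
            linarith
          · have : t / ρ0 ≤ t / (G / (12 * t * δ)) := by gcongr; exact le_max_right _ _
            have e : 36 * (t / δ) * (t * δ ^ 2 / G) = 3 * (t / (G / (12 * t * δ))) := by
              field_simp; ring
            rw [e]; linarith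
        · rw [← hGz, ENNReal.ofReal_zero, ENNReal.div_zero (by simp; positivity)]
          simp only [le_top, inf_of_le_left, mul_one]
          apply ENNReal.ofReal_le_ofReal
          have : t / ρ0 ≤ t / (δ / 2) := by gcongr; exact le_max_left _ _
          have e : t / (δ / 2) = 2 * (t / δ) := by field_simp
          have : 0 ≤ t / δ := by positivity
          linarith
    _ ≤ _ := by gcongr; exact min_one_le_rpow ha0 ha1

lemma volume_single (X t : ℝ) (ht : 0 < t) (ht1 : t ≤ 1) (a : ℝ) (ha0 : 0 ≤ a)
    (ha1 : a ≤ 1/2) :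
    volume {p ∈ uI | |Real.cos (2 * Real.pi * p) - X| ≤ t}
      ≤ ENNReal.ofReal (6 * √t) *
        (ENNReal.ofReal t / ENNReal.ofReal |1 - X ^ 2|) ^ a := by
  set G := |1 - X ^ 2| with hG
  have hG0 : 0 ≤ G := abs_nonneg _
  have hsq : √t ^ 2 = t := Real.sq_sqrt ht.le
  have hst : 0 < √t := Real.sqrt_pos.2 ht
  have hv1 : volume {p ∈ uI | |Real.cos (2 * Real.pi * p) - X| ≤ t} ≤ ENNReal.ofReal (3 / 2 * √t) := by
    have := volume_slab_sqrt 0 X t ht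
    simpa using this
  have main : volume {p ∈ uI | |Real.cos (2 * Real.pi * p) - X| ≤ t} ≤ ENNReal.ofReal (6 * √t) *
        (min 1 (ENNReal.ofReal t / ENNReal.ofReal G)) ^ (1/2 : ℝ) := by
    by_cases hc : 6 * t ≤ G
    · have hGp : 0 < G := by linarith
      have hρ : 0 < √(G / 2) := Real.sqrt_pos.2 (by linarith)
      have hv2 : volume {p ∈ uI | |Real.cos (2 * Real.pi * p) - X| ≤ t} ≤
          ENNReal.ofReal (3 / 2 * (t / √(G / 2))) := by
        refine le_trans (measure_mono ?_) (volume_slab 0 X t (√(G / 2)) ht hρ)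
        rintro p ⟨hp, h⟩
        refine ⟨hp, by simpa using h, ?_⟩
        rw [add_zero]
        apply Real.sqrt_le_iff.2 ⟨abs_nonneg _, _⟩
        rw [sq_abs]
        obtain ⟨x, hx⟩ : ∃ x, X = Real.cos (2 * Real.pi * p) + x := ⟨X - Real.cos (2 * Real.pi * p), by ring⟩
        have hx' : |x| ≤ t := by rw [hx] at h; simpa using h
        have hc1 := Real.abs_cos_le_one (2 * Real.pi * p)
        have h1 := Real.sin_sq_add_cos_sq (2 * Real.pi * p)
        have e : 1 - X ^ 2 = Real.sin (2 * Real.pi * p) ^ 2 - 2 * (x * Real.cos (2 * Real.pi * p)) - x ^ 2 := by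
          rw [hx]; linarith
        have b1 : |x * Real.cos (2 * Real.pi * p)| ≤ t * 1 := by rw [abs_mul]; gcongr
        have b2 : x ^ 2 ≤ t ^ 2 := sq_le_sq' (by linarith [(abs_le.1 hx').1]) (abs_le.1 hx').2
        have b3 : G ≤ Real.sin (2 * Real.pi * p) ^ 2 + 3 * t := by
          rw [hG, e]
          rw [abs_le] at b1 ⊢
          have := sq_nonneg x
          have := sq_nonneg (Real.sin (2 * Real.pi * p))
          constructor <;> nlinarith
        linarith
      refine hv2.trans ?_
      have : min 1 (ENNReal.ofReal t / ENNReal.ofReal G) = ENNReal.ofReal (t / G) := by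
        rw [← ENNReal.ofReal_div_of_pos hGp, min_eq_right]
        rw [← ENNReal.ofReal_one]
        apply ENNReal.ofReal_le_ofReal
        rw [div_le_one hGp]; linarith
      rw [this, ENNReal.ofReal_rpow_of_nonneg (by positivity) (by norm_num),
        ← ENNReal.ofReal_mul (by positivity), ← Real.sqrt_eq_rpow]
      apply ENNReal.ofReal_le_ofReal
      have e1 : t / √(G / 2) = √t * √(t / G) * √2 := by
        rw [Real.sqrt_div ht.le, Real.sqrt_div hGp.le]
        have : √G ≠ 0 := (Real.sqrt_pos.2 hGp).ne'
        field_simp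
        rw [hsq]
      rw [e1]
      have h2 : √2 ≤ 2 := by rw [Real.sqrt_le_left (by norm_num)]; norm_num
      have : 0 ≤ √t * √(t / G) := by positivity
      nlinarith
    · push Not at hc
      refine hv1.trans ?_
      have : ENNReal.ofReal (1/6) ≤ min 1 (ENNReal.ofReal t / ENNReal.ofReal G) := by
        refine le_min (by rw [← ENNReal.ofReal_one]; exact ENNReal.ofReal_le_ofReal (by norm_num)) ?_
        rcases hG0.lt_or_eq with hGp | hGz
        · rw [← ENNReal.ofReal_div_of_pos hGp]
          apply ENNReal.ofReal_le_ofReal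
          rw [le_div_iff₀ hGp]; linarith
        · rw [← hGz, ENNReal.ofReal_zero, ENNReal.div_zero (by simpa using ht)]; exact le_top
      calc ENNReal.ofReal (3 / 2 * √t) ≤ ENNReal.ofReal (6 * √t) * ENNReal.ofReal (1/6) ^ (1/2:ℝ) := by
            rw [ENNReal.ofReal_rpow_of_nonneg (by positivity) (by norm_num),
              ← ENNReal.ofReal_mul (by positivity), ← Real.sqrt_eq_rpow]
            apply ENNReal.ofReal_le_ofReal
            have : 1/4 ≤ √(1/6) := by apply Real.le_sqrt_of_sq_le; norm_num
            nlinarith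
        _ ≤ _ := by gcongr
  refine main.trans ?_
  gcongr
  calc (min 1 (ENNReal.ofReal t / ENNReal.ofReal G)) ^ (1/2 : ℝ)
      ≤ (min 1 (ENNReal.ofReal t / ENNReal.ofReal G)) ^ a :=
        ENNReal.rpow_le_rpow_of_exponent_ge (min_le_left _ _) ha1
    _ ≤ _ := by gcongr; exact min_le_right _ _


lemma G_alg (a b c1 s1 c3 s3 m : ℝ) (h1 : c1 ^ 2 + s1 ^ 2 = 1) (h3 : c3 ^ 2 + s3 ^ 2 = 1)
    (e1 : |(a - 1) ^ 2 + (b - c3) ^ 2 - 2 * (a - 1) * (b - c3) * c1 - s1 ^ 2| ≤ m)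
    (e2 : |(a + 1) ^ 2 + (b + c3) ^ 2 - 2 * (a + 1) * (b + c3) * c1 - s1 ^ 2| ≤ m)
    (e3 : |a ^ 2 + (b + s3) ^ 2 - 2 * a * (b + s3) * c1 - s1 ^ 2| ≤ m)
    (e4 : |a ^ 2 + (b - s3) ^ 2 - 2 * a * (b - s3) * c1 - s1 ^ 2| ≤ m) :
    s1 ^ 2 / 2 ≤ m ∨ |a| * s1 ^ 2 ≤ m := by
  rw [abs_le] at e1 e2 e3 e4
  by_cases hc : s3 ^ 2 ≤ (c1 - c3) ^ 2
  · left
    nlinarith [e1.1, e1.2, e2.1, e2.2, e3.1, e3.2, e4.1, e4.2]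
  · right
    push Not at hc
    set β := b - c1 * a with hβ
    have hs : |s3 * β| ≤ m / 2 := by
      rw [abs_le]
      constructor <;> nlinarith [e3.1, e3.2, e4.1, e4.2]
    have hcc : |a * s1 ^ 2 + β * (c3 - c1)| ≤ m / 2 := by
      have : s1 ^ 2 = 1 - c1 ^ 2 := by linarith
      rw [abs_le, this]
      constructor <;> nlinarith [e1.1, e1.2, e2.1, e2.2]
    have h5 : |c3 - c1| ≤ |s3| := by
      apply le_of_lt
      rw [← sq_lt_sq]; nlinarith
    have h6 : |β * (c3 - c1)| ≤ m / 2 := by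
      rw [abs_mul]
      rw [abs_mul] at hs
      nlinarith [abs_nonneg β]
    have : |a| * s1 ^ 2 = |a * s1 ^ 2| := by rw [abs_mul, abs_of_nonneg (sq_nonneg s1)]
    rw [this]
    calc |a * s1 ^ 2| = |(a * s1 ^ 2 + β * (c3 - c1)) - β * (c3 - c1)| := by ring_nf
      _ ≤ |a * s1 ^ 2 + β * (c3 - c1)| + |β * (c3 - c1)| := abs_sub _ _
      _ ≤ m := by linarith

lemma cs_0 : Real.cos (2 * Real.pi * 0) = 1 ∧ Real.sin (2 * Real.pi * 0) = 0 := by simp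
lemma cs_h : Real.cos (2 * Real.pi * (1/2)) = -1 ∧ Real.sin (2 * Real.pi * (1/2)) = 0 := by
  have : 2 * Real.pi * (1/2) = Real.pi := by ring
  rw [this]; simp
lemma cs_q : Real.cos (2 * Real.pi * (1/4)) = 0 ∧ Real.sin (2 * Real.pi * (1/4)) = 1 := by
  have : 2 * Real.pi * (1/4) = Real.pi / 2 := by ring
  rw [this]; simp
lemma cs_mq : Real.cos (2 * Real.pi * (-(1/4))) = 0 ∧ Real.sin (2 * Real.pi * (-(1/4))) = -1 := by
  have : 2 * Real.pi * (-(1/4)) = -(Real.pi / 2) := by ring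
  rw [this, Real.cos_neg, Real.sin_neg]; simp

lemma G_point (a b Q1 Q3 : ℝ) (g : ℝ → ℝ)
    (hg : ∀ z, g z = Gd Q1 (a - Real.cos (2 * Real.pi * z)) (b - Real.cos (2 * Real.pi * z + Q3))) :
    ∃ p0, Real.sin Q1 ^ 2 / 2 ≤ |g p0| ∨ |a| * Real.sin Q1 ^ 2 ≤ |g p0| := by
  by_contra hcon
  push Not at hcon
  obtain ⟨m, hm1, hm2, hm⟩ : ∃ m, m < Real.sin Q1 ^ 2 / 2 ∧ m < |a| * Real.sin Q1 ^ 2 ∧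
      (|g 0| ≤ m ∧ |g (1/2)| ≤ m ∧ |g (1/4)| ≤ m ∧ |g (-(1/4))| ≤ m) := by
    refine ⟨max (max |g 0| |g (1/2)|) (max |g (1/4)| |g (-(1/4))|), ?_, ?_, ?_⟩
    · simp only [max_lt_iff]
      exact ⟨⟨(hcon _).1, (hcon _).1⟩, (hcon _).1, (hcon _).1⟩
    · simp only [max_lt_iff]
      exact ⟨⟨(hcon _).2, (hcon _).2⟩, (hcon _).2, (hcon _).2⟩
    · simp
  obtain ⟨h1, h2, h3, h4⟩ := hm
  rw [hg, Gd, Real.cos_add, cs_0.1, cs_0.2] at h1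
  rw [hg, Gd, Real.cos_add, cs_h.1, cs_h.2] at h2
  rw [hg, Gd, Real.cos_add, cs_q.1, cs_q.2] at h3
  rw [hg, Gd, Real.cos_add, cs_mq.1, cs_mq.2] at h4
  have := G_alg a b (Real.cos Q1) (Real.sin Q1) (Real.cos Q3) (Real.sin Q3) m
    (Real.cos_sq_add_sin_sq Q1) (Real.cos_sq_add_sin_sq Q3)
    (by convert h1 using 2; ring) (by convert h2 using 2; ring) (by convert h3 using 2; ring)
    (by convert h4 using 2; ring)
  rcases this with h | h <;> linarith

lemma div_rpow_eq (x y : ENNReal) (a : ℝ) (ha : 0 ≤ a) : (x / y) ^ a = x ^ a * y ^ (-a) := by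
  rw [ENNReal.div_rpow_of_nonneg _ _ ha, ENNReal.rpow_neg, div_eq_mul_inv]

lemma inner_double (a b Q1 Q3 t : ℝ) (ht : 0 < t) (hQ : 0 < Real.sin Q1 ^ 2) (β : ℝ)
    (hb0 : 0 ≤ β) (hb : β < 1) :
    ∫⁻ z in uI, (ENNReal.ofReal (t * Real.sin Q1 ^ 2) / ENNReal.ofReal |Gd Q1
      (a - Real.cos (2 * Real.pi * z)) (b - Real.cos (2 * Real.pi * z + Q3))|) ^ (β / 4)
    ≤ ENNReal.ofReal (145 / (1 - β)) * (ENNReal.ofReal (2 * t) ^ (β / 4) *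
      (1 + ENNReal.ofReal |a| ^ (-(β / 4)))) := by
  set g : ℝ → ℝ := fun z => Gd Q1
      (a - Real.cos (2 * Real.pi * z)) (b - Real.cos (2 * Real.pi * z + Q3)) with hg
  obtain ⟨p0, hp0⟩ := G_point a b Q1 Q3 g (fun z => rfl)
  have ha : 0 ≤ β / 4 := by positivity
  have hmom := trig2_moment
    (a ^ 2 + b ^ 2 - 2 * a * b * Real.cos Q1 - Real.sin Q1 ^ 2)
    (- 2 * a - 2 * b * Real.cos Q3 + 2 * a * Real.cos Q3 * Real.cos Q1 + 2 * b * Real.cos Q1)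
    (2 * b * Real.sin Q3 - 2 * a * Real.sin Q3 * Real.cos Q1)
    (1 + Real.cos Q3 ^ 2 - 2 * Real.cos Q3 * Real.cos Q1)
    (- 2 * Real.cos Q3 * Real.sin Q3 + 2 * Real.sin Q3 * Real.cos Q1)
    (Real.sin Q3 ^ 2) g
    (by intro p; simp only [hg, Gd, Real.cos_add]; ring) β hb0 hb p0
  have e1 : ∀ z, (ENNReal.ofReal (t * Real.sin Q1 ^ 2) / ENNReal.ofReal |g z|) ^ (β / 4)
      = ENNReal.ofReal (t * Real.sin Q1 ^ 2) ^ (β / 4) * ENNReal.ofReal |g z| ^ (-(β / 4)) :=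
    fun z => div_rpow_eq _ _ _ ha
  calc ∫⁻ z in uI, (ENNReal.ofReal (t * Real.sin Q1 ^ 2) / ENNReal.ofReal |g z|) ^ (β / 4)
      = ENNReal.ofReal (t * Real.sin Q1 ^ 2) ^ (β / 4) *
        ∫⁻ z in uI, ENNReal.ofReal |g z| ^ (-(β / 4)) := by
        simp_rw [e1]
        rw [lintegral_const_mul']
        exact ENNReal.rpow_ne_top_of_nonneg ha ENNReal.ofReal_ne_top
    _ ≤ ENNReal.ofReal (t * Real.sin Q1 ^ 2) ^ (β / 4) * (ENNReal.ofReal (145 / (1 - β)) *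
        (ENNReal.ofReal |g p0|) ^ (-(β / 4))) := by gcongr
    _ = ENNReal.ofReal (145 / (1 - β)) *
        (ENNReal.ofReal (t * Real.sin Q1 ^ 2) / ENNReal.ofReal |g p0|) ^ (β / 4) := by
        rw [div_rpow_eq _ _ _ ha]; ring
    _ ≤ _ := by
        gcongr
        rcases hp0 with h | h
        · calc (ENNReal.ofReal (t * Real.sin Q1 ^ 2) / ENNReal.ofReal |g p0|) ^ (β / 4)
              ≤ (ENNReal.ofReal (t * Real.sin Q1 ^ 2) / ENNReal.ofReal (Real.sin Q1 ^ 2 / 2)) ^ (β / 4) := by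
                gcongr
            _ = ENNReal.ofReal (2 * t) ^ (β / 4) * 1 := by
                rw [← ENNReal.ofReal_div_of_pos (by positivity), mul_one]
                congr 2
                have hne : Real.sin Q1 ≠ 0 := fun h0 => by rw [h0] at hQ; norm_num at hQ
                field_simp
            _ ≤ _ := by gcongr; exact le_self_add
        · calc (ENNReal.ofReal (t * Real.sin Q1 ^ 2) / ENNReal.ofReal |g p0|) ^ (β / 4)
              ≤ (ENNReal.ofReal (t * Real.sin Q1 ^ 2) / ENNReal.ofReal (|a| * Real.sin Q1 ^ 2)) ^ (β / 4) := by
                gcongr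
            _ = (ENNReal.ofReal t / ENNReal.ofReal |a|) ^ (β / 4) := by
                rw [ENNReal.ofReal_mul ht.le, ENNReal.ofReal_mul (abs_nonneg a),
                  ENNReal.mul_div_mul_right _ _ (by simpa only [ne_eq, ENNReal.ofReal_eq_zero, not_le] using hQ) ENNReal.ofReal_ne_top]
            _ = ENNReal.ofReal t ^ (β / 4) * ENNReal.ofReal |a| ^ (-(β / 4)) :=
                div_rpow_eq _ _ _ ha
            _ ≤ _ := by
                gcongr
                · linarith
                · exact le_add_self

lemma outer_moment (A β : ℝ) (hb0 : 0 ≤ β) (hb : β < 1) :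
    ∫⁻ y in uI, (1 + ENNReal.ofReal |A - Real.cos (2 * Real.pi * y)| ^ (-(β / 4)))
      ≤ ENNReal.ofReal 147 := by
  obtain ⟨p0, hp0⟩ : ∃ p0, 1 ≤ |A - Real.cos (2 * Real.pi * p0)| := by
    rcases le_total A 0 with h | h
    · refine ⟨0, ?_⟩
      rw [cs_0.1, abs_of_nonpos (by linarith)]; linarith
    · refine ⟨1/2, ?_⟩
      rw [cs_h.1, abs_of_nonneg (by linarith)]; linarith
  have h := trig1_moment A (-1) 0 (fun y => A - Real.cos (2 * Real.pi * y))
    (by intro p; ring) (β / 2) (by linarith) (by linarith) p0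
  have e : β / 2 / 2 = β / 4 := by ring
  rw [e] at h
  rw [lintegral_add_left measurable_const]
  simp only [lintegral_const, MeasurableSet.univ, Measure.restrict_apply, Set.univ_inter, one_mul,
    volume_uI]
  have h2 : ENNReal.ofReal |A - Real.cos (2 * Real.pi * p0)| ^ (-(β / 4)) ≤ 1 := by
    have := rpow_anti (β / 4) (by linarith) (x := 1)
      (y := ENNReal.ofReal |A - Real.cos (2 * Real.pi * p0)|) (by simpa using hp0)
    simpa using this
  calc 1 + ∫⁻ y in uI, ENNReal.ofReal |A - Real.cos (2 * Real.pi * y)| ^ (-(β / 4))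
      ≤ 1 + ENNReal.ofReal (73 / (1 - β / 2)) * 1 := by
        gcongr
        exact h.trans (by gcongr)
    _ ≤ ENNReal.ofReal 1 + ENNReal.ofReal 146 := by
        rw [mul_one, ENNReal.ofReal_one]
        gcongr
        rw [div_le_iff₀ (by linarith)]; linarith
    _ = _ := by rw [← ENNReal.ofReal_add] <;> norm_num

def slabSet (Q1 X Y t : ℝ) : Set ℝ := {p ∈ uI | |Real.cos (2 * Real.pi * p) - X| ≤ t ∧
        |Real.cos (2 * Real.pi * p + Q1) - Y| ≤ t}

def Mint (Q1 Q2 Q3 A B t : ℝ) : ENNReal :=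
  ∫⁻ y in uI, ∫⁻ z in uI, volume (slabSet Q1
    (A - Real.cos (2 * Real.pi * y) - Real.cos (2 * Real.pi * z))
    (B - Real.cos (2 * Real.pi * y + Q2) - Real.cos (2 * Real.pi * z + Q3)) t)

lemma Mint_large (Q1 Q2 Q3 A B t : ℝ) (ht : 0 < t) (hQ : t ≤ Real.sin Q1 ^ 2) (β : ℝ)
    (hb0 : 0 ≤ β) (hb : β < 1) :
    Mint Q1 Q2 Q3 A B t ≤ ENNReal.ofReal (36 * (t / |Real.sin Q1|)) *
      (ENNReal.ofReal (145 / (1 - β)) * (ENNReal.ofReal (2 * t) ^ (β / 4) * ENNReal.ofReal 147)) := by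
  have ha : 0 ≤ β / 4 := by positivity
  unfold Mint
  calc _ ≤ ∫⁻ y in uI, ∫⁻ z in uI, ENNReal.ofReal (36 * (t / |Real.sin Q1|)) *
        (ENNReal.ofReal (t * Real.sin Q1 ^ 2) / ENNReal.ofReal |Gd Q1
          ((A - Real.cos (2 * Real.pi * y)) - Real.cos (2 * Real.pi * z))
          ((B - Real.cos (2 * Real.pi * y + Q2)) - Real.cos (2 * Real.pi * z + Q3))|) ^ (β / 4) := by
        apply lintegral_mono; intro y
        apply lintegral_mono; intro z
        exact volume_double Q1 _ _ t ht hQ _ ha (by linarith)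
    _ = ∫⁻ y in uI, ENNReal.ofReal (36 * (t / |Real.sin Q1|)) * ∫⁻ z in uI,
        (ENNReal.ofReal (t * Real.sin Q1 ^ 2) / ENNReal.ofReal |Gd Q1
          ((A - Real.cos (2 * Real.pi * y)) - Real.cos (2 * Real.pi * z))
          ((B - Real.cos (2 * Real.pi * y + Q2)) - Real.cos (2 * Real.pi * z + Q3))|) ^ (β / 4) := by
        congr 1; ext y
        rw [lintegral_const_mul' _ _ ENNReal.ofReal_ne_top]
    _ ≤ ∫⁻ y in uI, ENNReal.ofReal (36 * (t / |Real.sin Q1|)) *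
        (ENNReal.ofReal (145 / (1 - β)) * (ENNReal.ofReal (2 * t) ^ (β / 4) *
          (1 + ENNReal.ofReal |A - Real.cos (2 * Real.pi * y)| ^ (-(β / 4))))) := by
        apply lintegral_mono; intro y
        dsimp only
        gcongr
        exact inner_double _ _ Q1 Q3 t ht (by linarith) β hb0 hb
    _ = ENNReal.ofReal (36 * (t / |Real.sin Q1|)) *
        (ENNReal.ofReal (145 / (1 - β)) * (ENNReal.ofReal (2 * t) ^ (β / 4) * ∫⁻ y in uI,
          (1 + ENNReal.ofReal |A - Real.cos (2 * Real.pi * y)| ^ (-(β / 4))))) := by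
        rw [lintegral_const_mul' _ _ ENNReal.ofReal_ne_top,
          lintegral_const_mul' _ _ ENNReal.ofReal_ne_top,
          lintegral_const_mul' _ _ (ENNReal.rpow_ne_top_of_nonneg ha ENNReal.ofReal_ne_top)]
    _ ≤ _ := by
        gcongr
        exact outer_moment A β hb0 hb

lemma Mint_small (Q1 Q2 Q3 A B t : ℝ) (ht : 0 < t) (ht1 : t ≤ 1) (β : ℝ)
    (hb0 : 0 ≤ β) (hb : β < 1) :
    Mint Q1 Q2 Q3 A B t ≤ ENNReal.ofReal (6 * √t) *
      (ENNReal.ofReal (145 / (1 - β)) * ENNReal.ofReal (2 * t) ^ (β / 4)) := by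
  have ha : 0 ≤ β / 4 := by positivity
  have key : ∀ y, ∫⁻ z in uI, volume (slabSet Q1
    (A - Real.cos (2 * Real.pi * y) - Real.cos (2 * Real.pi * z))
    (B - Real.cos (2 * Real.pi * y + Q2) - Real.cos (2 * Real.pi * z + Q3)) t) ≤
      ENNReal.ofReal (6 * √t) *
      (ENNReal.ofReal (145 / (1 - β)) * ENNReal.ofReal (2 * t) ^ (β / 4)) := by
    intro y
    set a := A - Real.cos (2 * Real.pi * y) with ha'
    set g : ℝ → ℝ := fun z => 1 - (a - Real.cos (2 * Real.pi * z)) ^ 2 with hg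
    obtain ⟨p0, hp0⟩ : ∃ p0, 1 / 2 ≤ |g p0| := by
      by_contra hcon
      push Not at hcon
      have h1 := hcon 0
      have h2 := hcon (1/2)
      have h3 := hcon (1/4)
      simp only [hg] at h1 h2 h3
      rw [cs_0.1, abs_lt] at h1
      rw [cs_h.1, abs_lt] at h2
      rw [cs_q.1, abs_lt] at h3
      nlinarith [h1.1, h1.2, h2.1, h2.2, h3.1, h3.2]
    have hmom := trig2_moment (1 - a ^ 2) (2 * a) 0 (-1) 0 0 g
      (by intro p; simp only [hg]; ring) β hb0 hb p0
    calc _ ≤ ∫⁻ z in uI, ENNReal.ofReal (6 * √t) *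
          (ENNReal.ofReal t ^ (β / 4) * ENNReal.ofReal |g z| ^ (-(β / 4))) := by
          apply lintegral_mono; intro z
          dsimp only
          rw [← div_rpow_eq _ _ _ ha]
          refine le_trans (measure_mono ?_) (volume_single (a - Real.cos (2 * Real.pi * z)) t ht ht1 (β / 4) ha (by linarith))
          intro p hp
          exact ⟨hp.1, hp.2.1⟩
      _ = ENNReal.ofReal (6 * √t) *
          (ENNReal.ofReal t ^ (β / 4) * ∫⁻ z in uI, ENNReal.ofReal |g z| ^ (-(β / 4))) := by
          rw [lintegral_const_mul' _ _ ENNReal.ofReal_ne_top,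
            lintegral_const_mul' _ _ (ENNReal.rpow_ne_top_of_nonneg ha ENNReal.ofReal_ne_top)]
      _ ≤ ENNReal.ofReal (6 * √t) *
          (ENNReal.ofReal t ^ (β / 4) * (ENNReal.ofReal (145 / (1 - β)) *
            ENNReal.ofReal (1/2) ^ (-(β / 4)))) := by
          gcongr
          refine hmom.trans ?_
          exact mul_le_mul_right (rpow_anti _ ha (ENNReal.ofReal_le_ofReal hp0)) _
      _ = ENNReal.ofReal (6 * √t) *
          (ENNReal.ofReal (145 / (1 - β)) * (ENNReal.ofReal t / ENNReal.ofReal (1/2)) ^ (β / 4)) := by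
          rw [div_rpow_eq _ _ _ ha]; ring
      _ = _ := by
          rw [← ENNReal.ofReal_div_of_pos (by norm_num)]
          congr 4; ring
  unfold Mint
  calc _ ≤ ∫⁻ y in uI, ENNReal.ofReal (6 * √t) *
      (ENNReal.ofReal (145 / (1 - β)) * ENNReal.ofReal (2 * t) ^ (β / 4)) :=
        lintegral_mono key
    _ = _ := by simp [volume_uI]

lemma b_facts (η : ℝ) (h0 : 0 < η) (h1 : η ≤ 1/2) : ∃ β : ℝ, 0 ≤ β ∧ β < 1 ∧
    1 / (1 - β) ≤ 3 * |Real.log η| ∧ η ^ (β / 4) ≤ (3/2) * η ^ (1/4 : ℝ) ∧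
    η ^ (β / 2) ≤ 2 * η ^ (1/2 : ℝ) ∧ 1/2 ≤ |Real.log η| := by
  have hl : Real.log η < 0 := Real.log_neg h0 (by linarith)
  have hl2 : 1/2 ≤ |Real.log η| := by
    rw [abs_of_neg hl]
    have : Real.log η ≤ Real.log (1/2) := Real.log_le_log h0 h1
    rw [one_div, Real.log_inv] at this
    have := Real.log_two_gt_d9
    linarith
  set L := 1 + |Real.log η| with hL
  have hLpos : 1 ≤ L := by rw [hL]; linarith
  have hgen : ∀ s : ℝ, 0 ≤ s → η ^ ((1 - 1 / L) * s) ≤ Real.exp s * η ^ s := by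
    intro s hs
    rw [Real.rpow_def_of_pos h0, Real.rpow_def_of_pos h0, ← Real.exp_add, Real.exp_le_exp]
    have : |Real.log η| * (1 / L) ≤ 1 := by
      rw [mul_one_div, div_le_one (by linarith)]; linarith
    rw [abs_of_neg hl] at this
    nlinarith
  have he : Real.exp 1 < 3 := Real.exp_one_lt_three
  have he2 : Real.exp (1/2) ≤ 2 := by
    have : Real.exp (1/2) * Real.exp (1/2) = Real.exp 1 := by rw [← Real.exp_add]; norm_num
    nlinarith [Real.exp_pos (1/2)]
  have he4 : Real.exp (1/4) ≤ 3/2 := by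
    have : Real.exp (1/4) * Real.exp (1/4) = Real.exp (1/2) := by rw [← Real.exp_add]; norm_num
    nlinarith [Real.exp_pos (1/4)]
  refine ⟨1 - 1 / L, ?_, ?_, ?_, ?_, ?_, hl2⟩
  · have : 1 / L ≤ 1 := by rw [div_le_one (by linarith)]; exact hLpos
    linarith
  · have : 0 < 1 / L := by positivity
    linarith
  · have : 1 / (1 - (1 - 1 / L)) = L := by field_simp; ring
    rw [this, hL]; linarith
  · have := hgen (1/4) (by norm_num)
    have e : (1 - 1 / L) / 4 = (1 - 1 / L) * (1/4) := by ring
    rw [e]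
    exact this.trans (by gcongr)
  · have := hgen (1/2) (by norm_num)
    have e : (1 - 1 / L) / 2 = (1 - 1 / L) * (1/2) := by ring
    rw [e]
    exact this.trans (by gcongr)

lemma Mint_bound (Q1 Q2 Q3 A B η : ℝ) (h0 : 0 < η) (h1 : η ≤ 1/2) :
    Mint Q1 Q2 Q3 A B η ≤ ENNReal.ofReal
      (30000000 * η ^ (5/4 : ℝ) * |Real.log η| / (|Real.sin Q1| + η)) := by
  obtain ⟨β, hb0, hb1, hbl, hb4, hb2, hl2⟩ := b_facts η h0 h1
  set l := |Real.log η| with hl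
  have hr : (145 / (1 - β)) ≤ 435 * l := by
    have : 145 / (1 - β) = 145 * (1 / (1 - β)) := by ring
    rw [this]; linarith
  have h2t : (2 * η) ^ (β / 4) ≤ 3 * η ^ (1/4 : ℝ) := by
    rw [Real.mul_rpow (by norm_num) h0.le]
    have : (2 : ℝ) ^ (β / 4) ≤ 2 := by
      calc (2 : ℝ) ^ (β / 4) ≤ 2 ^ (1 : ℝ) :=
            Real.rpow_le_rpow_of_exponent_le (by norm_num) (by linarith)
        _ = 2 := by norm_num
    calc (2 : ℝ) ^ (β / 4) * η ^ (β / 4) ≤ 2 * ((3/2) * η ^ (1/4 : ℝ)) := by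
          apply mul_le_mul this hb4 (by positivity) (by norm_num)
      _ = _ := by ring
  have hE : ENNReal.ofReal (2 * η) ^ (β / 4) ≤ ENNReal.ofReal (3 * η ^ (1/4 : ℝ)) := by
    rw [ENNReal.ofReal_rpow_of_pos (by linarith)]
    exact ENNReal.ofReal_le_ofReal h2t
  set r := η ^ (1/4 : ℝ) with hrr
  have hr0 : 0 < r := by positivity
  have hr4 : η = r ^ 4 := by
    rw [hrr, ← Real.rpow_natCast, ← Real.rpow_mul h0.le]; norm_num
  have hr5 : η ^ (5/4 : ℝ) = r ^ 5 := by
    rw [hrr, ← Real.rpow_natCast, ← Real.rpow_mul h0.le]; norm_num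
  have hsq : √η = r ^ 2 := by
    rw [Real.sqrt_eq_rpow, hrr, ← Real.rpow_natCast, ← Real.rpow_mul h0.le]; norm_num
  rw [hr5]
  have hs0 := abs_nonneg (Real.sin Q1)
  set s := |Real.sin Q1| with hs
  have hl0 : 0 < l := by linarith
  rcases le_or_gt η (Real.sin Q1 ^ 2) with hc | hc
  · have hc' : η ≤ s ^ 2 := by rw [hs, sq_abs]; exact hc
    have hs1 : s ≤ 1 := Real.abs_sin_le_one Q1
    have hspos : 0 < s := by
      rcases hs0.lt_or_eq with h | h
      · exact h
      · rw [← h] at hc'; norm_num at hc'; linarith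
    have hηs : η ≤ s := by nlinarith
    calc _ ≤ _ := Mint_large Q1 Q2 Q3 A B η h0 hc β hb0 hb1
      _ ≤ ENNReal.ofReal (36 * (η / s)) * (ENNReal.ofReal (435 * l) *
          (ENNReal.ofReal (3 * r) * ENNReal.ofReal 147)) := by gcongr
      _ = ENNReal.ofReal (36 * (η / s) * (435 * l * (3 * r * 147))) := by
          rw [← ENNReal.ofReal_mul (by positivity), ← ENNReal.ofReal_mul (by positivity),
            ← ENNReal.ofReal_mul (by positivity)]
      _ ≤ _ := by
          apply ENNReal.ofReal_le_ofReal
          rw [le_div_iff₀ (by linarith)]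
          have : 36 * (η / s) * (435 * l * (3 * r * 147)) * (s + η) =
            (36 * 435 * 3 * 147) * (η * r) * l * ((s + η) / s) := by field_simp
          rw [this]
          have h3 : (s + η) / s ≤ 2 := by rw [div_le_iff₀ hspos]; linarith
          have h4 : η * r = r ^ 5 := by rw [hr4]; ring
          rw [h4]
          calc (36 * 435 * 3 * 147) * r ^ 5 * l * ((s + η) / s) ≤ (36 * 435 * 3 * 147) * r ^ 5 * l * 2 := by
                gcongr
            _ ≤ _ := by nlinarith [mul_pos (pow_pos hr0 5) hl0]
  · have hc' : s ^ 2 < η := by rw [hs, sq_abs]; exact hc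
    have hsr : s ≤ r ^ 2 := by
      apply le_of_lt
      apply lt_of_pow_lt_pow_left₀ 2 (by positivity)
      rw [hr4] at hc'; nlinarith
    calc _ ≤ _ := Mint_small Q1 Q2 Q3 A B η h0 (by linarith) β hb0 hb1
      _ ≤ ENNReal.ofReal (6 * √η) * (ENNReal.ofReal (435 * l) * ENNReal.ofReal (3 * r)) := by gcongr
      _ = ENNReal.ofReal (6 * √η * (435 * l * (3 * r))) := by
          rw [← ENNReal.ofReal_mul (by positivity), ← ENNReal.ofReal_mul (by positivity)]
      _ ≤ _ := by
          apply ENNReal.ofReal_le_ofReal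
          rw [le_div_iff₀ (by linarith), hsq]
          have hr1 : r ≤ 1 := by
            rw [hrr]; exact Real.rpow_le_one h0.le (by linarith) (by norm_num)
          have h3 : s + η ≤ 2 * r ^ 2 := by
            rw [hr4]
            have : r ^ 4 ≤ r ^ 2 := pow_le_pow_of_le_one hr0.le hr1 (by norm_num)
            linarith
          calc 6 * r ^ 2 * (435 * l * (3 * r)) * (s + η) ≤ 6 * r ^ 2 * (435 * l * (3 * r)) * (2 * r ^ 2) := by
                gcongr
            _ = 15660 * (r ^ 5 * l) := by ring
            _ ≤ _ := by nlinarith [mul_pos (pow_pos hr0 5) hl0]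



lemma T3_tonelli (i : Fin 3) (f : (Fin 3 → ℝ) → ENNReal) (hf : Measurable f) :
    ∫⁻ p in T3, f p = ∫⁻ y in uI, ∫⁻ z in uI, ∫⁻ x in uI, f (i.insertNth x ![y, z]) := by
  have e0 : (volume : Measure (Fin 3 → ℝ)).restrict T3 = Measure.pi (fun _ => volume.restrict uI) := by
    unfold T3
    rw [volume_pi, Measure.restrict_pi_pi]
    rfl
  rw [e0]
  have h1 := measurePreserving_piFinSuccAbove (fun _ : Fin 3 => (volume.restrict uI : Measure ℝ)) i
  have h1s := h1.symm
  rw [← h1s.lintegral_comp hf]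
  have hm1 : Measurable fun x : ℝ × (Fin 2 → ℝ) =>
      f ((MeasurableEquiv.piFinSuccAbove (fun _ : Fin 3 => ℝ) i).symm x) :=
    hf.comp (MeasurableEquiv.measurable _)
  rw [lintegral_prod_symm _ hm1.aemeasurable]
  have h2 := (measurePreserving_finTwoArrow (volume.restrict uI : Measure ℝ)).symm
  rw [← h2.lintegral_comp hm1.lintegral_prod_left']
  rw [lintegral_prod]
  · rfl
  · exact (hm1.lintegral_prod_left'.comp (MeasurableEquiv.measurable _)).aemeasurable

lemma edisp_insert (i : Fin 3) (x y z : ℝ) : edisp (i.insertNth x ![y, z]) =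
    3 - Real.cos (2 * Real.pi * x) - Real.cos (2 * Real.pi * y) - Real.cos (2 * Real.pi * z) := by
  unfold edisp
  rw [Fin.sum_univ_succAbove _ i]
  simp [Fin.sum_univ_two]
  ring

lemma edisp_insert_add (i : Fin 3) (x y z : ℝ) (q : Fin 3 → ℝ) :
    edisp ((i.insertNth x ![y, z] : Fin 3 → ℝ) + q) =
    3 - Real.cos (2 * Real.pi * x + 2 * Real.pi * q i)
      - Real.cos (2 * Real.pi * y + 2 * Real.pi * q (i.succAbove 0))
      - Real.cos (2 * Real.pi * z + 2 * Real.pi * q (i.succAbove 1)) := by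
  unfold edisp
  rw [Fin.sum_univ_succAbove _ i]
  simp [Fin.sum_univ_two, mul_add]
  ring

lemma edisp_meas : Measurable edisp := by
  unfold edisp
  fun_prop

lemma edisp_nonneg (p : Fin 3 → ℝ) : 0 ≤ edisp p := by
  unfold edisp
  exact Finset.sum_nonneg fun j _ => by linarith [Real.cos_le_one (2 * Real.pi * p j)]

lemma edisp_le (p : Fin 3 → ℝ) : edisp p ≤ 6 := by
  unfold edisp
  rw [Fin.sum_univ_three]
  linarith [Real.neg_one_le_cos (2 * Real.pi * p 0), Real.neg_one_le_cos (2 * Real.pi * p 1),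
    Real.neg_one_le_cos (2 * Real.pi * p 2)]

lemma volume_T3 : volume T3 = 1 := by
  unfold T3
  rw [volume_pi, Measure.pi_pi]
  have := volume_uI
  unfold uI at this
  simp only [this, Finset.prod_const_one]

lemma M_T3 (q : Fin 3 → ℝ) (i : Fin 3) (A B η : ℝ) (h0 : 0 < η) (h1 : η ≤ 1/2) :
    ∫⁻ p in T3, ({p | |edisp p - A| ≤ η ∧ |edisp (p + q) - B| ≤ η} : Set (Fin 3 → ℝ)).indicator 1 p
     ≤ ENNReal.ofReal
      (30000000 * η ^ (5/4 : ℝ) * |Real.log η| / (|Real.sin (2 * Real.pi * q i)| + η)) := by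
  have hS : MeasurableSet {p | |edisp p - A| ≤ η ∧ |edisp (p + q) - B| ≤ η} := by
    have := edisp_meas
    have h2 : Measurable fun p => edisp (p + q) := edisp_meas.comp (measurable_id.add_const q)
    apply MeasurableSet.inter
    · exact measurableSet_le (f := fun p => |edisp p - A|) (by fun_prop) measurable_const
    · exact measurableSet_le (f := fun p => |edisp (p + q) - B|) (by fun_prop) measurable_const
  rw [T3_tonelli i _ (measurable_one.indicator hS)]
  refine le_trans (le_of_eq ?_) (Mint_bound (2 * Real.pi * q i) (2 * Real.pi * q (i.succAbove 0))
    (2 * Real.pi * q (i.succAbove 1)) (3 - A) (3 - B) η h0 h1)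
  unfold Mint
  congr 1; ext y
  congr 1; ext z
  have hms : MeasurableSet (slabSet (2 * Real.pi * q i)
    (3 - A - Real.cos (2 * Real.pi * y) - Real.cos (2 * Real.pi * z))
    (3 - B - Real.cos (2 * Real.pi * y + 2 * Real.pi * q (i.succAbove 0))
       - Real.cos (2 * Real.pi * z + 2 * Real.pi * q (i.succAbove 1))) η) := by
    unfold slabSet
    apply MeasurableSet.inter measurableSet_uI
    apply MeasurableSet.inter
    · exact measurableSet_le (f := fun p : ℝ => |Real.cos (2 * Real.pi * p) - _|)
        (by fun_prop) measurable_const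
    · exact measurableSet_le (f := fun p : ℝ => |Real.cos (2 * Real.pi * p + _) - _|)
        (by fun_prop) measurable_const
  rw [← lintegral_indicator_one hms, ← lintegral_indicator measurableSet_uI]
  congr 1; ext x
  by_cases hx : x ∈ uI
  · rw [Set.indicator_of_mem hx]
    have : (i.insertNth x ![y, z] : Fin 3 → ℝ) ∈ {p | |edisp p - A| ≤ η ∧ |edisp (p + q) - B| ≤ η} ↔
      x ∈ (slabSet (2 * Real.pi * q i)
    (3 - A - Real.cos (2 * Real.pi * y) - Real.cos (2 * Real.pi * z))
    (3 - B - Real.cos (2 * Real.pi * y + 2 * Real.pi * q (i.succAbove 0))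
       - Real.cos (2 * Real.pi * z + 2 * Real.pi * q (i.succAbove 1))) η) := by
      simp only [slabSet, Set.mem_ofPred_eq, edisp_insert, edisp_insert_add, hx, true_and]
      apply and_congr
      · rw [← abs_neg]
        ring_nf
      · rw [← abs_neg]
        ring_nf
    by_cases hm : x ∈ (slabSet (2 * Real.pi * q i)
      (3 - A - Real.cos (2 * Real.pi * y) - Real.cos (2 * Real.pi * z))
      (3 - B - Real.cos (2 * Real.pi * y + 2 * Real.pi * q (i.succAbove 0))
       - Real.cos (2 * Real.pi * z + 2 * Real.pi * q (i.succAbove 1))) η)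
    · rw [Set.indicator_of_mem hm, Set.indicator_of_mem (this.2 hm)]; rfl
    · rw [Set.indicator_of_notMem hm, Set.indicator_of_notMem (fun h => hm (this.1 h))]
  · rw [Set.indicator_of_notMem hx, Set.indicator_of_notMem]
    exact fun h => hx h.1



lemma harm_real (n : ℕ) : ∑ k ∈ Finset.range n, 1 / (1 + (k : ℝ)) ≤ 1 + Real.log n := by
  have h := harmonic_le_one_add_log n
  refine le_trans (le_of_eq ?_) h
  unfold harmonic
  push_cast
  apply Finset.sum_congr rfl
  intro k _
  rw [one_div, add_comm]

lemma sum_shift_aux (y : ℝ) (N : ℕ) (hy0 : 0 ≤ y) (hyN : y ≤ N) :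
    ∑ m ∈ Finset.range N, 1 / (1 + |y - m|) ≤ 2 * (1 + Real.log (N + 1 : ℕ)) := by
  set f := ⌊y⌋₊ with hf
  have hf1 : (f : ℝ) ≤ y := Nat.floor_le hy0
  have hf2 : y < f + 1 := Nat.lt_floor_add_one y
  have hfN : f ≤ N := by
    have : (f : ℝ) ≤ N := hf1.trans hyN
    exact_mod_cast this
  have hnn : ∀ m : ℕ, 0 ≤ 1 / (1 + |y - m|) := fun m => by positivity
  have hmonoH : ∀ a : ℕ, a ≤ N + 1 → ∑ k ∈ Finset.range a, 1 / (1 + (k : ℝ)) ≤ 1 + Real.log (N + 1 : ℕ) := by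
    intro a ha
    refine le_trans ?_ (harm_real (N + 1))
    apply Finset.sum_le_sum_of_subset_of_nonneg
    · exact Finset.range_mono ha
    · intros; positivity
  calc ∑ m ∈ Finset.range N, 1 / (1 + |y - m|)
      ≤ ∑ m ∈ Finset.range (f + 1 + N), 1 / (1 + |y - m|) := by
        apply Finset.sum_le_sum_of_subset_of_nonneg
        · exact Finset.range_mono (by omega)
        · intro m _ _; exact hnn m
    _ = ∑ m ∈ Finset.range (f + 1), 1 / (1 + |y - m|) +
        ∑ k ∈ Finset.range N, 1 / (1 + |y - ((f + 1 + k : ℕ) : ℝ)|) := by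
        rw [Finset.sum_range_add]
    _ ≤ ∑ k ∈ Finset.range (f + 1), 1 / (1 + (k : ℝ)) + ∑ k ∈ Finset.range N, 1 / (1 + (k : ℝ)) := by
        apply add_le_add
        · rw [← Finset.sum_range_reflect (fun k : ℕ => 1 / (1 + (k : ℝ)))]
          apply Finset.sum_le_sum
          intro m hm
          rw [Finset.mem_range] at hm
          have e : ((f + 1 - 1 - m : ℕ) : ℝ) = f - m := by
            rw [Nat.add_sub_cancel, Nat.cast_sub (by omega)]
          rw [e]
          have h3 : (m : ℝ) ≤ f := by exact_mod_cast (by omega : m ≤ f)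
          apply one_div_le_one_div_of_le
          · linarith
          · rw [abs_of_nonneg (by linarith)]; linarith
        · apply Finset.sum_le_sum
          intro k _
          have hk : (0 : ℝ) ≤ k := Nat.cast_nonneg k
          apply one_div_le_one_div_of_le
          · linarith
          · push_cast
            rw [abs_of_nonpos (by linarith)]; linarith
    _ ≤ _ := by
        have h1 := hmonoH (f + 1) (by omega)
        have h2 := hmonoH N (by omega)
        linarith

lemma sum_shift (y : ℝ) (N : ℕ) :
    ∑ m ∈ Finset.range N, 1 / (1 + |y - m|) ≤ 2 * (1 + Real.log (N + 1 : ℕ)) := by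
  have key : ∀ y' : ℝ, 0 ≤ y' → y' ≤ N → (∀ m : ℕ, m < N → |y' - m| ≤ |y - m|) →
      ∑ m ∈ Finset.range N, 1 / (1 + |y - m|) ≤ 2 * (1 + Real.log (N + 1 : ℕ)) := by
    intro y' h0 hN h
    refine le_trans (Finset.sum_le_sum ?_) (sum_shift_aux y' N h0 hN)
    intro m hm
    have := h m (Finset.mem_range.1 hm)
    gcongr
  rcases le_total y 0 with h | h
  · refine key 0 le_rfl (Nat.cast_nonneg N) ?_
    intro m _
    have hm : (0 : ℝ) ≤ m := Nat.cast_nonneg m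
    rw [abs_of_nonpos (by linarith), abs_of_nonpos (by linarith)]; linarith
  · rcases le_total y N with h' | h'
    · exact key y h h' fun m _ => le_rfl
    · refine key N (Nat.cast_nonneg N) le_rfl ?_
      intro m hm
      have hm' : (m : ℝ) ≤ N := by exact_mod_cast hm.le
      rw [abs_of_nonneg (by linarith), abs_of_nonneg (by linarith)]; linarith

def kw (η α : ℝ) (m : ℕ) : ℝ := 2 / (|α - m * η| + η)

lemma kw_nonneg (η α : ℝ) (h0 : 0 < η) (m : ℕ) : 0 ≤ kw η α m := by unfold kw; positivity

lemma kw_sum (η α : ℝ) (h0 : 0 < η) (h1 : η ≤ 1/2) :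
    ∑ m ∈ Finset.range (⌊6 / η⌋₊ + 1), kw η α m ≤ 24 * |Real.log η| / η := by
  have hl : Real.log η < 0 := Real.log_neg h0 (by linarith)
  have hl2 : Real.log 2 ≤ |Real.log η| := by
    rw [abs_of_neg hl]
    have : Real.log η ≤ Real.log (1/2) := Real.log_le_log h0 h1
    rw [one_div, Real.log_inv] at this
    linarith
  have hlog2 := Real.log_two_gt_d9
  set N := ⌊6 / η⌋₊ + 1 with hN
  have hNle : ((N + 1 : ℕ) : ℝ) ≤ 8 / η := by
    have := Nat.floor_le (show 0 ≤ 6 / η by positivity)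
    rw [hN]; push_cast
    have h2 : 2 ≤ 2 / η := by rw [le_div_iff₀ h0]; linarith
    have : 8 / η = 6 / η + 2 / η := by ring
    linarith
  have hlogN : Real.log (N + 1 : ℕ) ≤ 4 * |Real.log η| := by
    calc Real.log (N + 1 : ℕ) ≤ Real.log (8 / η) := Real.log_le_log (by positivity) hNle
      _ = 3 * Real.log 2 + |Real.log η| := by
          rw [Real.log_div (by norm_num) h0.ne', abs_of_neg hl,
            show (8 : ℝ) = 2 ^ (3 : ℕ) by norm_num, Real.log_pow]
          push_cast; ring
      _ ≤ _ := by linarith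
  have e : ∀ m : ℕ, kw η α m = 2 / η * (1 / (1 + |α / η - m|)) := by
    intro m
    unfold kw
    have : |α - m * η| + η = η * (1 + |α / η - m|) := by
      have h3 : α - m * η = η * (α / η - m) := by field_simp
      rw [h3, abs_mul, abs_of_pos h0]; ring
    rw [this]
    have : 0 < 1 + |α / η - m| := by positivity
    field_simp
  simp_rw [e]
  rw [← Finset.mul_sum]
  have hs := sum_shift (α / η) N
  calc 2 / η * ∑ m ∈ Finset.range N, 1 / (1 + |α / η - m|)
      ≤ 2 / η * (12 * |Real.log η|) := by
        gcongr
        linarith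
    _ = _ := by ring

lemma norm_lower (u η : ℝ) (h0 : 0 < η) (x : ℝ) :
    (|u - x| + η) / 2 ≤ ‖(u : ℂ) - (x : ℂ) + (η : ℂ) * Complex.I‖ := by
  have h1 := Complex.abs_re_le_norm ((u : ℂ) - (x : ℂ) + (η : ℂ) * Complex.I)
  have h2 := Complex.abs_im_le_norm ((u : ℂ) - (x : ℂ) + (η : ℂ) * Complex.I)
  simp at h1 h2
  rw [abs_of_pos h0] at h2
  linarith

lemma cell_ex (η α x : ℝ) (h0 : 0 < η) (hx0 : 0 ≤ x) (hx6 : x ≤ 6) :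
    ∃ m ∈ Finset.range (⌊6 / η⌋₊ + 1), |x - m * η| ≤ η ∧ 1 / (|α - x| + η) ≤ kw η α m := by
  have hf1 : (⌊x / η⌋₊ : ℝ) ≤ x / η := Nat.floor_le (by positivity)
  have hf2 : x / η < ⌊x / η⌋₊ + 1 := Nat.lt_floor_add_one _
  rw [le_div_iff₀ h0] at hf1
  rw [div_lt_iff₀ h0] at hf2
  refine ⟨⌊x / η⌋₊, ?_, ?_, ?_⟩
  · rw [Finset.mem_range, Nat.lt_succ_iff]
    apply Nat.floor_le_floor
    gcongr
  · rw [abs_le]; constructor <;> linarith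
  · unfold kw
    rw [div_le_div_iff₀ (by positivity) (by positivity)]
    have : |α - ⌊x / η⌋₊ * η| ≤ |α - x| + η := by
      calc |α - ⌊x / η⌋₊ * η| = |(α - x) + (x - ⌊x / η⌋₊ * η)| := by ring_nf
        _ ≤ |α - x| + |x - ⌊x / η⌋₊ * η| := abs_add_le _ _
        _ ≤ _ := by
          have : |x - ⌊x / η⌋₊ * η| ≤ η := by rw [abs_le]; constructor <;> linarith
          linarith
    linarith [abs_nonneg (α - x)]

lemma ker_le (α β x y η : ℝ) (h0 : 0 < η) :
    1 / (‖(α : ℂ) - (x : ℂ) + (η : ℂ) * Complex.I‖ * ‖(β : ℂ) - (y : ℂ) + (η : ℂ) * Complex.I‖)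
      ≤ 4 * (1 / (|α - x| + η)) * (1 / (|β - y| + η)) := by
  have h1 := norm_lower α η h0 x
  have h2 := norm_lower β η h0 y
  have p1 : 0 < (|α - x| + η) / 2 := by positivity
  have p2 : 0 < (|β - y| + η) / 2 := by positivity
  calc _ ≤ 1 / ((|α - x| + η) / 2 * ((|β - y| + η) / 2)) := by
        apply one_div_le_one_div_of_le (by positivity)
        exact mul_le_mul h1 h2 p2.le (p1.le.trans h1)
    _ = _ := by field_simp; norm_num

lemma part_one (η : ℝ) (h0 : 0 < η) (h1 : η ≤ 1/2) (q : Fin 3 → ℝ) (i : Fin 3) (α β : ℝ) :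
    ∫⁻ p in T3, ENNReal.ofReal (1 / (‖(α : ℂ) - (edisp p : ℂ) + (η : ℂ) * Complex.I‖ *
        ‖(β : ℂ) - (edisp (p + q) : ℂ) + (η : ℂ) * Complex.I‖)) ≤
      ENNReal.ofReal (69120000000 * η ^ (-(3/4) : ℝ) * |Real.log η| ^ 3 /
        (|Real.sin (2 * Real.pi * q i)| + η)) := by
  set N := ⌊6 / η⌋₊ + 1 with hN
  set S : ℕ → ℕ → Set (Fin 3 → ℝ) := fun m n =>
    {p | |edisp p - m * η| ≤ η ∧ |edisp (p + q) - n * η| ≤ η} with hS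
  have hSm : ∀ m n, MeasurableSet (S m n) := by
    intro m n
    have := edisp_meas
    have h2 : Measurable fun p => edisp (p + q) := edisp_meas.comp (measurable_id.add_const q)
    apply MeasurableSet.inter
    · exact measurableSet_le (f := fun p => |edisp p - m * η|) (by fun_prop) measurable_const
    · exact measurableSet_le (f := fun p => |edisp (p + q) - n * η|) (by fun_prop) measurable_const
  set M := 30000000 * η ^ (5/4 : ℝ) * |Real.log η| / (|Real.sin (2 * Real.pi * q i)| + η) with hM
  have hM0 : 0 ≤ M := by positivity
  have hk := kw_nonneg η α h0
  have hk' := kw_nonneg η β h0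
  calc _ ≤ ∫⁻ p in T3, ∑ m ∈ Finset.range N, ∑ n ∈ Finset.range N,
        ENNReal.ofReal (4 * kw η α m * kw η β n) * (S m n).indicator 1 p := by
        apply lintegral_mono
        intro p
        dsimp only
        obtain ⟨m, hm, hm1, hm2⟩ := cell_ex η α (edisp p) h0 (edisp_nonneg p) (edisp_le p)
        obtain ⟨n, hn, hn1, hn2⟩ := cell_ex η β (edisp (p + q)) h0 (edisp_nonneg _) (edisp_le _)
        have hmem : p ∈ S m n := ⟨hm1, hn1⟩
        calc _ ≤ ENNReal.ofReal (4 * kw η α m * kw η β n) * (S m n).indicator 1 p := by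
              rw [Set.indicator_of_mem hmem, Pi.one_apply, mul_one]
              apply ENNReal.ofReal_le_ofReal
              refine (ker_le α β _ _ η h0).trans ?_
              have := hk m
              gcongr
          _ ≤ ∑ n ∈ Finset.range N, ENNReal.ofReal (4 * kw η α m * kw η β n) * (S m n).indicator 1 p :=
              Finset.single_le_sum (f := fun n => ENNReal.ofReal (4 * kw η α m * kw η β n) * (S m n).indicator 1 p)
                (fun _ _ => zero_le) hn
          _ ≤ _ :=
              Finset.single_le_sum (f := fun m => ∑ n ∈ Finset.range N, ENNReal.ofReal (4 * kw η α m * kw η β n) * (S m n).indicator 1 p)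
                (fun _ _ => zero_le) hm
    _ = ∑ m ∈ Finset.range N, ∑ n ∈ Finset.range N,
        ENNReal.ofReal (4 * kw η α m * kw η β n) * ∫⁻ p in T3, (S m n).indicator 1 p := by
        rw [lintegral_finsetSum]
        · apply Finset.sum_congr rfl
          intro m _
          rw [lintegral_finsetSum]
          · apply Finset.sum_congr rfl
            intro n _
            rw [lintegral_const_mul' _ _ ENNReal.ofReal_ne_top]
          · intro n _
            exact (measurable_one.indicator (hSm m n)).const_mul _
        · intro m _
          apply Finset.measurable_sum
          intro n _
          exact (measurable_one.indicator (hSm m n)).const_mul _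
    _ ≤ ∑ m ∈ Finset.range N, ∑ n ∈ Finset.range N,
        ENNReal.ofReal (4 * kw η α m * kw η β n) * ENNReal.ofReal M := by
        apply Finset.sum_le_sum; intro m _
        apply Finset.sum_le_sum; intro n _
        gcongr
        exact M_T3 q i _ _ η h0 h1
    _ = ENNReal.ofReal (∑ m ∈ Finset.range N, ∑ n ∈ Finset.range N, 4 * kw η α m * kw η β n * M) := by
        rw [ENNReal.ofReal_sum_of_nonneg]
        · apply Finset.sum_congr rfl; intro m _
          rw [ENNReal.ofReal_sum_of_nonneg]
          · apply Finset.sum_congr rfl; intro n _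
            have := hk m
            have := hk' n
            rw [← ENNReal.ofReal_mul (by positivity)]
          · intro n _
            have := hk m
            have := hk' n
            positivity
        · intro m _
          apply Finset.sum_nonneg
          intro n _
          have := hk m
          have := hk' n
          positivity
    _ ≤ _ := by
        apply ENNReal.ofReal_le_ofReal
        have e : ∑ m ∈ Finset.range N, ∑ n ∈ Finset.range N, 4 * kw η α m * kw η β n * M =
            4 * (∑ m ∈ Finset.range N, kw η α m) * (∑ n ∈ Finset.range N, kw η β n) * M := by
          rw [mul_assoc 4, Finset.sum_mul_sum, Finset.mul_sum, Finset.sum_mul]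
          apply Finset.sum_congr rfl; intro m _
          rw [Finset.mul_sum, Finset.sum_mul]
          apply Finset.sum_congr rfl; intro n _
          ring
        rw [e]
        have s1 := kw_sum η α h0 h1
        have s2 := kw_sum η β h0 h1
        have n1 : 0 ≤ ∑ m ∈ Finset.range N, kw η α m := Finset.sum_nonneg fun m _ => hk m
        have n2 : 0 ≤ ∑ m ∈ Finset.range N, kw η β m := Finset.sum_nonneg fun m _ => hk' m
        calc _ ≤ 4 * (24 * |Real.log η| / η) * (24 * |Real.log η| / η) * M := by gcongr
          _ = _ := by
            rw [hM]
            have : η ^ (5/4 : ℝ) = η ^ 2 * η ^ (-(3/4) : ℝ) := by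
              rw [← Real.rpow_natCast, ← Real.rpow_add h0]; norm_num
            rw [this]
            have : 0 < |Real.sin (2 * Real.pi * q i)| + η := by positivity
            field_simp
            ring



lemma inv_le_pow (u η s : ℝ) (hu : 0 ≤ u) (h0 : 0 < η) (hs0 : 0 ≤ s) (hs1 : s ≤ 1) :
    ENNReal.ofReal (1 / (u + η)) ≤ ENNReal.ofReal (η ^ (s - 1)) * ENNReal.ofReal u ^ (-s) := by
  rcases hs0.eq_or_lt with h | h
  · rw [← h]
    simp only [neg_zero, ENNReal.rpow_zero, mul_one, zero_sub]
    apply ENNReal.ofReal_le_ofReal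
    rw [Real.rpow_neg_one, one_div]
    exact inv_anti₀ h0 (by linarith)
  · rcases hu.eq_or_lt with h' | h'
    · rw [← h', ENNReal.ofReal_zero, ENNReal.zero_rpow_of_neg (by linarith), ENNReal.mul_top]
      · exact le_top
      · have : 0 < η ^ (s - 1) := by positivity
        simpa only [ne_eq, ENNReal.ofReal_eq_zero, not_le] using this
    · rw [ENNReal.ofReal_rpow_of_pos h', ← ENNReal.ofReal_mul (by positivity)]
      apply ENNReal.ofReal_le_ofReal
      have e : η ^ (s - 1) * u ^ (-s) = 1 / (η ^ (1 - s) * u ^ s) := by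
        rw [show s - 1 = -(1 - s) by ring, Real.rpow_neg h0.le, Real.rpow_neg hu]
        field_simp
      rw [e]
      apply one_div_le_one_div_of_le (by positivity)
      calc η ^ (1 - s) * u ^ s ≤ (u + η) ^ (1 - s) * (u + η) ^ s := by
            gcongr
            · linarith
            · linarith
        _ = u + η := by
            rw [← Real.rpow_add (by linarith)]; norm_num

lemma alpha_int (η : ℝ) (h0 : 0 < η) (h1 : η ≤ 1/2) (x : ℝ) :
    ∫⁻ α in Set.Icc (-12 : ℝ) 12, ENNReal.ofReal (1 / (|α - x| + η)) ≤
      ENNReal.ofReal (216 * |Real.log η|) := by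
  obtain ⟨b, hb0, hb, hbl, -, hb2, hl2⟩ := b_facts η h0 h1
  have hη : η ^ (b - 1) ≤ 4 := by
    have e : η ^ (b - 1) = (η ^ (b / 2)) ^ 2 / η := by
      rw [Real.rpow_sub h0, Real.rpow_one, ← Real.rpow_natCast, ← Real.rpow_mul h0.le]
      norm_num
    have e2 : (η ^ (1/2 : ℝ)) ^ 2 = η := by
      rw [← Real.rpow_natCast, ← Real.rpow_mul h0.le]; norm_num
    rw [e, div_le_iff₀ h0]
    have : 0 < η ^ (b / 2) := by positivity
    nlinarith
  have key : ∀ α : ℝ, ENNReal.ofReal (1 / (|α - x| + η)) ≤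
      ENNReal.ofReal 4 * ((Set.Icc (-1:ℝ) 1).indicator (fun y => (ENNReal.ofReal |y|) ^ (-b)) (α - x) + 1) := by
    intro α
    refine (inv_le_pow |α - x| η b (abs_nonneg _) h0 hb0 hb.le).trans ?_
    gcongr
    by_cases h : |α - x| ≤ 1
    · rw [Set.indicator_of_mem (by rw [Set.mem_Icc, ← abs_le]; exact h)]
      exact le_self_add
    · rw [Set.indicator_of_notMem (by rw [Set.mem_Icc, ← abs_le]; exact h), zero_add]
      push Not at h
      have := rpow_anti b hb0 (x := 1) (y := ENNReal.ofReal |α - x|) (by simpa using h.le)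
      simpa using this
  calc _ ≤ ∫⁻ α in Set.Icc (-12 : ℝ) 12, ENNReal.ofReal 4 *
        ((Set.Icc (-1:ℝ) 1).indicator (fun y => (ENNReal.ofReal |y|) ^ (-b)) (α - x) + 1) :=
        lintegral_mono key
    _ = ENNReal.ofReal 4 * ((∫⁻ α in Set.Icc (-12 : ℝ) 12,
        (Set.Icc (-1:ℝ) 1).indicator (fun y => (ENNReal.ofReal |y|) ^ (-b)) (α - x)) + ENNReal.ofReal 24) := by
        rw [lintegral_const_mul' _ _ ENNReal.ofReal_ne_top, lintegral_add_right _ measurable_const]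
        simp
        norm_num
    _ ≤ ENNReal.ofReal 4 * ((∫⁻ α,
        (Set.Icc (-1:ℝ) 1).indicator (fun y => (ENNReal.ofReal |y|) ^ (-b)) (α - x)) + ENNReal.ofReal 24) := by
        gcongr
        exact Measure.restrict_le_self
    _ = ENNReal.ofReal 4 * ((∫⁻ α in Set.Icc (-1:ℝ) 1,
        (ENNReal.ofReal |α|) ^ (-b)) + ENNReal.ofReal 24) := by
        rw [lintegral_sub_right_eq_self
          (fun y => (Set.Icc (-1:ℝ) 1).indicator (fun y => (ENNReal.ofReal |y|) ^ (-b)) y) x,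
          lintegral_indicator measurableSet_Icc]
    _ ≤ ENNReal.ofReal 4 * (ENNReal.ofReal (2 / (1 - b)) + ENNReal.ofReal 24) := by
        gcongr
        exact lint_pow_ball b hb0 hb
    _ = ENNReal.ofReal (4 * (2 / (1 - b) + 24)) := by
        have : 0 < 1 - b := by linarith
        rw [← ENNReal.ofReal_add (by positivity) (by norm_num), ← ENNReal.ofReal_mul (by norm_num)]
    _ ≤ _ := by
        apply ENNReal.ofReal_le_ofReal
        have : 2 / (1 - b) = 2 * (1 / (1 - b)) := by ring
        rw [this]; linarith

lemma D_int (η : ℝ) (h0 : 0 < η) (h1 : η ≤ 1/2) (q : Fin 3 → ℝ) (i : Fin 3) :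
    ∫⁻ p in T3, ENNReal.ofReal (1 / (|edisp p - edisp (p + q)| + η)) ≤
      ENNReal.ofReal (1000 * η ^ (-(1/2) : ℝ) * |Real.log η| /
        (|Real.sin (2 * Real.pi * q i)| + η)) := by
  obtain ⟨b, hb0, hb, hbl, -, hb2, hl2⟩ := b_facts η h0 h1
  have hs0 := abs_nonneg (Real.sin (2 * Real.pi * q i))
  have hs1 := Real.abs_sin_le_one (2 * Real.pi * q i)
  set δ := |Real.sin (2 * Real.pi * q i)| with hδ
  set l := |Real.log η| with hl
  have hhalf : 1 ≤ η ^ (-(1/2) : ℝ) :=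
    Real.one_le_rpow_of_pos_of_le_one_of_nonpos h0 (by linarith) (by norm_num)
  rcases lt_or_ge δ η with hc | hc
  · calc _ ≤ ∫⁻ p in T3, ENNReal.ofReal (1 / η) := by
          apply lintegral_mono; intro p
          apply ENNReal.ofReal_le_ofReal
          apply one_div_le_one_div_of_le h0
          linarith [abs_nonneg (edisp p - edisp (p + q))]
      _ = ENNReal.ofReal (1 / η) := by simp [volume_T3]
      _ ≤ _ := by
          apply ENNReal.ofReal_le_ofReal
          rw [div_le_div_iff₀ h0 (by linarith)]
          have : 1 ≤ 2 * (η ^ (-(1/2) : ℝ) * l) := by nlinarith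
          nlinarith
  · have hδ0 : 0 < δ := by linarith
    have hmeas : Measurable fun p => ENNReal.ofReal (1 / (|edisp p - edisp (p + q)| + η)) := by
      have := edisp_meas
      have h2 : Measurable fun p => edisp (p + q) := edisp_meas.comp (measurable_id.add_const q)
      fun_prop
    rw [T3_tonelli i _ hmeas]
    have hηb : η ^ (b / 2 - 1) ≤ 2 * η ^ (-(1/2) : ℝ) := by
      have e : η ^ (-(1/2) : ℝ) = η ^ (1/2 : ℝ) / η := by
        rw [show (-(1/2) : ℝ) = 1/2 - 1 by norm_num, Real.rpow_sub h0, Real.rpow_one]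
      rw [Real.rpow_sub h0, Real.rpow_one, e, ← mul_div_assoc]
      gcongr
    have key : ∀ y z : ℝ, ∫⁻ x in uI, ENNReal.ofReal (1 / (|edisp (i.insertNth x ![y, z]) -
        edisp ((i.insertNth x ![y, z] : Fin 3 → ℝ) + q)| + η)) ≤
        ENNReal.ofReal (1000 * η ^ (-(1/2) : ℝ) * l / (δ + η)) := by
      intro y z
      set g : ℝ → ℝ := fun x => edisp (i.insertNth x ![y, z]) -
        edisp ((i.insertNth x ![y, z] : Fin 3 → ℝ) + q) with hg
      set k := - Real.cos (2 * Real.pi * y) - Real.cos (2 * Real.pi * z)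
        + Real.cos (2 * Real.pi * y + 2 * Real.pi * q (i.succAbove 0))
        + Real.cos (2 * Real.pi * z + 2 * Real.pi * q (i.succAbove 1)) with hk
      have hgx : ∀ x, g x = k + (Real.cos (2 * Real.pi * q i) - 1) * Real.cos (2 * Real.pi * x)
          + (- Real.sin (2 * Real.pi * q i)) * Real.sin (2 * Real.pi * x) := by
        intro x
        simp only [hg, edisp_insert, edisp_insert_add, hk]
        rw [Real.cos_add (2 * Real.pi * x)]
        ring
      obtain ⟨p0, hp0⟩ : ∃ p0, δ ≤ |g p0| := by
        by_contra hcon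
        push Not at hcon
        have a1 := hcon (1/4)
        have a2 := hcon (-(1/4))
        rw [hgx, cs_q.1, cs_q.2, abs_lt] at a1
        rw [hgx, cs_mq.1, cs_mq.2, abs_lt] at a2
        rcases abs_cases (Real.sin (2 * Real.pi * q i)) with ⟨h, _⟩ | ⟨h, _⟩ <;>
          linarith [a1.1, a1.2, a2.1, a2.2]
      have hmom := trig1_moment _ _ _ g hgx b hb0 hb p0
      have hδb : ENNReal.ofReal |g p0| ^ (-(b / 2)) ≤ ENNReal.ofReal (1 / δ) := by
        refine (rpow_anti (b / 2) (by linarith) (ENNReal.ofReal_le_ofReal hp0)).trans ?_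
        rw [ENNReal.ofReal_rpow_of_pos hδ0]
        apply ENNReal.ofReal_le_ofReal
        rw [one_div, ← Real.rpow_neg_one]
        exact Real.rpow_le_rpow_of_exponent_ge hδ0 hs1 (by linarith)
      have h1b : 0 < 1 - b := by linarith
      calc _ ≤ ∫⁻ x in uI, ENNReal.ofReal (η ^ (b / 2 - 1)) * ENNReal.ofReal |g x| ^ (-(b / 2)) := by
            apply lintegral_mono; intro x
            exact inv_le_pow |g x| η (b / 2) (abs_nonneg _) h0 (by linarith) (by linarith)
        _ = ENNReal.ofReal (η ^ (b / 2 - 1)) * ∫⁻ x in uI, ENNReal.ofReal |g x| ^ (-(b / 2)) :=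
            lintegral_const_mul' _ _ ENNReal.ofReal_ne_top
        _ ≤ ENNReal.ofReal (2 * η ^ (-(1/2) : ℝ)) *
            (ENNReal.ofReal (73 / (1 - b)) * ENNReal.ofReal (1 / δ)) := by
            gcongr
            exact hmom.trans (by gcongr)
        _ = ENNReal.ofReal (2 * η ^ (-(1/2) : ℝ) * (73 / (1 - b) * (1 / δ))) := by
            rw [← ENNReal.ofReal_mul (by positivity), ← ENNReal.ofReal_mul (by positivity)]
        _ ≤ _ := by
            apply ENNReal.ofReal_le_ofReal
            have e73 : 73 / (1 - b) ≤ 219 * l := by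
              have : 73 / (1 - b) = 73 * (1 / (1 - b)) := by ring
              rw [this]; linarith
            have ed : 1 / δ ≤ 2 / (δ + η) := by
              rw [div_le_div_iff₀ hδ0 (by linarith)]; linarith
            calc _ ≤ 2 * η ^ (-(1/2) : ℝ) * (219 * l * (2 / (δ + η))) := by gcongr
              _ = 876 * η ^ (-(1/2) : ℝ) * l / (δ + η) := by ring
              _ ≤ _ := by gcongr; norm_num
    calc _ ≤ ∫⁻ y in uI, ∫⁻ z in uI, ENNReal.ofReal (1000 * η ^ (-(1/2) : ℝ) * l / (δ + η)) := by
          apply lintegral_mono; intro y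
          apply lintegral_mono; intro z
          exact key y z
      _ = _ := by simp [volume_uI]

lemma ker_two (α x y η : ℝ) (h0 : 0 < η) :
    (1 / (|α - x| + η)) * (1 / (|α - y| + η)) ≤
      (1 / (|α - x| + η) + 1 / (|α - y| + η)) * (1 / (|x - y| + η)) := by
  have h : |x - y| ≤ |α - x| + |α - y| := by
    calc |x - y| = |(α - y) - (α - x)| := by ring_nf
      _ ≤ |α - y| + |α - x| := abs_sub _ _
      _ = _ := add_comm _ _
  have p1 : 0 < |α - x| + η := by positivity
  have p2 : 0 < |α - y| + η := by positivity
  have p3 : 0 < |x - y| + η := by positivity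
  have e : 1 / (|α - x| + η) + 1 / (|α - y| + η) =
      (1 / (|α - x| + η)) * (1 / (|α - y| + η)) * (|α - x| + η + (|α - y| + η)) := by
    field_simp; ring
  rw [e, mul_assoc ((1 / (|α - x| + η)) * (1 / (|α - y| + η)))]
  apply le_mul_of_one_le_right (by positivity)
  rw [mul_one_div, le_div_iff₀ p3]
  linarith

lemma part_two (η : ℝ) (h0 : 0 < η) (h1 : η ≤ 1/2) (q : Fin 3 → ℝ) (i : Fin 3) :
    ∫⁻ α in Set.Icc (-12 : ℝ) 12, ∫⁻ p in T3,
      ENNReal.ofReal (1 / (‖(α : ℂ) - (edisp p : ℂ) + (η : ℂ) * Complex.I‖ *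
        ‖(α : ℂ) - (edisp (p + q) : ℂ) + (η : ℂ) * Complex.I‖)) ≤
      ENNReal.ofReal (4000000 * η ^ (-(1/2) : ℝ) * |Real.log η| ^ 3 /
        (|Real.sin (2 * Real.pi * q i)| + η)) := by
  obtain ⟨b, hb0, hb, hbl, -, hb2, hl2⟩ := b_facts η h0 h1
  set δ := |Real.sin (2 * Real.pi * q i)| with hδ
  have hs0 : 0 ≤ δ := abs_nonneg _
  set l := |Real.log η| with hl
  have hm1 := edisp_meas
  have hm2 : Measurable fun p => edisp (p + q) := edisp_meas.comp (measurable_id.add_const q)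
  calc _ ≤ ∫⁻ α in Set.Icc (-12 : ℝ) 12, ∫⁻ p in T3, ENNReal.ofReal 4 *
        ((ENNReal.ofReal (1 / (|α - edisp p| + η)) + ENNReal.ofReal (1 / (|α - edisp (p + q)| + η))) *
          ENNReal.ofReal (1 / (|edisp p - edisp (p + q)| + η))) := by
        apply lintegral_mono; intro α
        apply lintegral_mono; intro p
        dsimp only
        rw [← ENNReal.ofReal_add (by positivity) (by positivity),
          ← ENNReal.ofReal_mul (by positivity), ← ENNReal.ofReal_mul (by positivity)]
        apply ENNReal.ofReal_le_ofReal
        refine (ker_le α α _ _ η h0).trans ?_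
        have := ker_two α (edisp p) (edisp (p + q)) η h0
        rw [mul_assoc]
        gcongr
    _ = ∫⁻ p in T3, ∫⁻ α in Set.Icc (-12 : ℝ) 12, ENNReal.ofReal 4 *
        ((ENNReal.ofReal (1 / (|α - edisp p| + η)) + ENNReal.ofReal (1 / (|α - edisp (p + q)| + η))) *
          ENNReal.ofReal (1 / (|edisp p - edisp (p + q)| + η))) := by
        rw [lintegral_lintegral_swap]
        apply Measurable.aemeasurable
        unfold Function.uncurry
        have hm1' : Measurable fun a : ℝ × (Fin 3 → ℝ) => edisp a.2 := hm1.comp measurable_snd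
        have hm2' : Measurable fun a : ℝ × (Fin 3 → ℝ) => edisp (a.2 + q) := hm2.comp measurable_snd
        fun_prop
    _ ≤ ∫⁻ p in T3, ENNReal.ofReal (1728 * l) *
          ENNReal.ofReal (1 / (|edisp p - edisp (p + q)| + η)) := by
        apply lintegral_mono; intro p
        dsimp only
        rw [lintegral_const_mul' _ _ ENNReal.ofReal_ne_top,
          lintegral_mul_const' _ _ ENNReal.ofReal_ne_top, lintegral_add_left (by fun_prop),
          ← mul_assoc]
        gcongr
        calc _ ≤ ENNReal.ofReal 4 * (ENNReal.ofReal (216 * l) + ENNReal.ofReal (216 * l)) := by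
              gcongr
              · exact alpha_int η h0 h1 _
              · exact alpha_int η h0 h1 _
          _ = _ := by
              rw [← ENNReal.ofReal_add (by positivity) (by positivity),
                ← ENNReal.ofReal_mul (by positivity)]
              congr 1; ring
    _ = ENNReal.ofReal (1728 * l) * ∫⁻ p in T3,
          ENNReal.ofReal (1 / (|edisp p - edisp (p + q)| + η)) :=
        lintegral_const_mul' _ _ ENNReal.ofReal_ne_top
    _ ≤ ENNReal.ofReal (1728 * l) * ENNReal.ofReal (1000 * η ^ (-(1/2) : ℝ) * l / (δ + η)) := by
        gcongr
        exact D_int η h0 h1 q i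
    _ = ENNReal.ofReal (1728 * l * (1000 * η ^ (-(1/2) : ℝ) * l / (δ + η))) := by
        rw [← ENNReal.ofReal_mul (by positivity)]
    _ ≤ _ := by
        apply ENNReal.ofReal_le_ofReal
        rw [← mul_div_assoc]
        apply div_le_div_of_nonneg_right _ (by positivity)
        have : l ^ 2 ≤ 2 * l ^ 3 := by nlinarith [sq_nonneg l]
        have h5 : 0 < η ^ (-(1/2) : ℝ) := by positivity
        calc 1728 * l * (1000 * η ^ (-(1/2) : ℝ) * l) = 1728000 * η ^ (-(1/2) : ℝ) * l ^ 2 := by ring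
          _ ≤ 1728000 * η ^ (-(1/2) : ℝ) * (2 * l ^ 3) := by gcongr
          _ = 3456000 * η ^ (-(1/2) : ℝ) * l ^ 3 := by ring
          _ ≤ _ := by gcongr; norm_num



lemma crit_dist (x : ℝ) : min (cdist x 0) (cdist x (1/2)) ≤ |Real.sin (2 * Real.pi * x)| / 4 := by
  have h := abs_sin_round (2 * x)
  have e : Real.pi * (2 * x) = 2 * Real.pi * x := by ring
  rw [e] at h
  set k := round (2 * x) with hk
  rcases Int.even_or_odd' k with ⟨c, hc | hc⟩
  · refine (min_le_left _ _).trans ?_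
    unfold cdist
    have h1 := round_le (x - 0) c
    have : |x - 0 - c| = |2 * x - k| / 2 := by
      rw [hc]; push_cast
      rw [show 2 * x - 2 * (c : ℝ) = 2 * (x - 0 - c) by ring, abs_mul]; norm_num
    linarith
  · refine (min_le_right _ _).trans ?_
    unfold cdist
    have h1 := round_le (x - 1/2) c
    have : |x - 1/2 - c| = |2 * x - k| / 2 := by
      rw [hc]; push_cast
      rw [show 2 * x - (2 * (c : ℝ) + 1) = 2 * (x - 1/2 - c) by ring, abs_mul]; norm_num
    linarith

lemma tnorm_le (η : ℝ) (q : Fin 3 → ℝ) :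
    ∃ i : Fin 3, tnorm η q ≤ |Real.sin (2 * Real.pi * q i)| + η := by
  obtain ⟨i, hi⟩ := Finite.exists_max (fun j : Fin 3 => |Real.sin (2 * Real.pi * q j)|)
  refine ⟨i, ?_⟩
  unfold tnorm
  rw [add_comm]
  gcongr
  set δ := |Real.sin (2 * Real.pi * q i)| with hδ
  have hδ0 : 0 ≤ δ := abs_nonneg _
  apply Real.sqrt_le_iff.2 ⟨hδ0, ?_⟩
  have hj : ∀ j, (min (cdist (q j) 0) (cdist (q j) (1/2))) ^ 2 ≤ (δ / 4) ^ 2 := by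
    intro j
    have h1 := crit_dist (q j)
    have h2 := hi j
    have h3 : 0 ≤ min (cdist (q j) 0) (cdist (q j) (1/2)) := by
      unfold cdist; exact le_min (abs_nonneg _) (abs_nonneg _)
    apply pow_le_pow_left₀ h3
    linarith
  rw [Fin.sum_univ_three]
  have a0 := hj 0
  have a1 := hj 1
  have a2 := hj 2
  nlinarith [sq_nonneg δ]

lemma tnorm_pos (η : ℝ) (h0 : 0 < η) (q : Fin 3 → ℝ) : 0 < tnorm η q := by
  unfold tnorm; positivity

lemma le_of_enorm (x C : ℝ) (hC : 0 ≤ C) (h : ‖x‖ₑ ≤ ENNReal.ofReal C) : x ≤ C := by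
  rw [Real.enorm_eq_ofReal_abs, ENNReal.ofReal_le_ofReal_iff hC] at h
  exact (le_abs_self x).trans h

theorem main13 :
    ∃ c : ℝ, 0 < c ∧
      ∀ η : ℝ, 0 < η → η ≤ 1/2 →
        ∀ q : Fin 3 → ℝ,
          (∀ α β : ℝ,
            (∫ p in T3,
                1 /
                  (‖(α : ℂ) - (edisp p : ℂ) + (η : ℂ) * Complex.I‖ *
                    ‖(β : ℂ) - (edisp (p + q) : ℂ) + (η : ℂ) * Complex.I‖)) ≤
              c * η ^ (-(3/4) : ℝ) * |Real.log η| ^ (3 : ℕ) / tnorm η q) ∧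
          ((∫ α in Set.Icc (-12 : ℝ) 12, ∫ p in T3,
                1 /
                  (‖(α : ℂ) - (edisp p : ℂ) + (η : ℂ) * Complex.I‖ *
                    ‖(α : ℂ) - (edisp (p + q) : ℂ) + (η : ℂ) * Complex.I‖)) ≤
              c * η ^ (-(1/2) : ℝ) * |Real.log η| ^ (3 : ℕ) / tnorm η q) := by
  refine ⟨69120000000, by norm_num, ?_⟩
  intro η h0 h1 q
  obtain ⟨i, hi⟩ := tnorm_le η q
  have htp := tnorm_pos η h0 q
  have hen : ∀ α β : ℝ, ‖∫ p in T3,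
                1 /
                  (‖(α : ℂ) - (edisp p : ℂ) + (η : ℂ) * Complex.I‖ *
                    ‖(β : ℂ) - (edisp (p + q) : ℂ) + (η : ℂ) * Complex.I‖)‖ₑ ≤
      ∫⁻ p in T3, ENNReal.ofReal (1 / (‖(α : ℂ) - (edisp p : ℂ) + (η : ℂ) * Complex.I‖ *
        ‖(β : ℂ) - (edisp (p + q) : ℂ) + (η : ℂ) * Complex.I‖)) := by
    intro α β
    refine (enorm_integral_le_lintegral_enorm _).trans (le_of_eq ?_)
    congr 1; ext p
    rw [Real.enorm_eq_ofReal_abs, abs_of_nonneg (by positivity)]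
  constructor
  · intro α β
    apply le_of_enorm _ _ (by positivity)
    refine ((hen α β).trans (part_one η h0 h1 q i α β)).trans ?_
    apply ENNReal.ofReal_le_ofReal
    gcongr
  · apply le_of_enorm _ _ (by positivity)
    refine (enorm_integral_le_lintegral_enorm _).trans ?_
    refine (lintegral_mono fun α => hen α α).trans ?_
    refine (part_two η h0 h1 q i).trans ?_
    apply ENNReal.ofReal_le_ofReal
    gcongr
    norm_num


/-- There is `c > 0` such that for all `0 < η ≤ 1/2`, all `α, β ∈ ℝ`
and all `q ∈ 𝕋³`:
(i) `∫ dp / (|α - e(p) + iη| |β - e(p+q) + iη|) ≤ c η^{-3/4} |log η|³ / |||q|||`;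
(ii) `∫_{-12}^{12} dα ∫ dp / (|α - e(p) + iη| |α - e(p+q) + iη|)
        ≤ c η^{-1/2} |log η|³ / |||q|||`. -/
theorem statement13 :
    ∃ c : ℝ, 0 < c ∧
      ∀ η : ℝ, 0 < η → η ≤ 1/2 →
        ∀ q : Fin 3 → ℝ,
          (∀ α β : ℝ,
            (∫ p in T3,
                1 /
                  (‖(α : ℂ) - (edisp p : ℂ) + (η : ℂ) * Complex.I‖ *
                    ‖(β : ℂ) - (edisp (p + q) : ℂ) + (η : ℂ) * Complex.I‖)) ≤
              c * η ^ (-(3/4) : ℝ) * |Real.log η| ^ (3 : ℕ) / tnorm η q) ∧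
          ((∫ α in Set.Icc (-12 : ℝ) 12, ∫ p in T3,
                1 /
                  (‖(α : ℂ) - (edisp p : ℂ) + (η : ℂ) * Complex.I‖ *
                    ‖(α : ℂ) - (edisp (p + q) : ℂ) + (η : ℂ) * Complex.I‖)) ≤
              c * η ^ (-(1/2) : ℝ) * |Real.log η| ^ (3 : ℕ) / tnorm η q) := by
  exact main13

end
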